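/- arXiv:1012.6012 — 3 statements merged into one kernel-verified Lean document; each statement's English description precedes it below -/
import Mathlib

section
/- (Corollary 3, noisy feedback for Dueck) Consider the generalized Dueck DMBC with H(Z₀,Z₁) ≤ 1 and H(Z₀,Z₂) ≤ 1, and suppose Z₁ — Z₀ — Z₂ does NOT form a Markov chain. Consider the noisy feedback signal Ỹ = (Y_{1,1}⊕W₁, Y_{1,0}⊕W₀, Y_{2,2}⊕W₂), where (W₀,W₁,W₂) are binary random variables with marginals W_i ~ Bern(q_i), drawn independently of the channel input and of (Z₀,Z₁,Z₂), i.i.d. across channel uses. Then there exists q̄ > 0 such that for every joint law of (W₀,W₁,W₂) with max{q₀,q₁,q₂} ≤ q̄, the noisy-feedback capacity region strictly contains the no-feedback capacity region: C_NoFB ⊊ C_NoisyFB. -/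
open scoped BigOperators Classical

noncomputable section

namespace BCFB

variable {Ω A B C : Type*}

/-- Probability of an event under a weight function on a finite sample space. -/
def prOf [Fintype Ω] (w : Ω → ℝ) (E : Ω → Prop) : ℝ :=
  ∑ ω, if E ω then w ω else 0

/-- Distribution (pushforward) of a random variable. -/
def distOf [Fintype Ω] (w : Ω → ℝ) (X : Ω → A) : A → ℝ :=
  fun a => prOf w fun ω => X ω = a

/-- Shannon entropy (base 2) of a random variable. -/
def entOf [Fintype Ω] [Fintype A] (w : Ω → ℝ) (X : Ω → A) : ℝ :=
  -∑ a, distOf w X a * Real.logb 2 (distOf w X a)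

/-- Mutual information (base 2). -/
def miOf [Fintype Ω] [Fintype A] [Fintype B] (w : Ω → ℝ) (X : Ω → A) (Y : Ω → B) : ℝ :=
  entOf w X + entOf w Y - entOf w fun ω => (X ω, Y ω)

/-- Conditional mutual information I(X;Y|Z) (base 2). -/
def cmiOf [Fintype Ω] [Fintype A] [Fintype B] [Fintype C]
    (w : Ω → ℝ) (X : Ω → A) (Y : Ω → B) (Z : Ω → C) : ℝ :=
  entOf w (fun ω => (X ω, Z ω)) + entOf w (fun ω => (Y ω, Z ω))
    - entOf w (fun ω => (X ω, Y ω, Z ω)) - entOf w Z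

/-- `w` is a probability mass function. -/
def IsPMF [Fintype Ω] (w : Ω → ℝ) : Prop := (∀ ω, 0 ≤ w ω) ∧ ∑ ω, w ω = 1

/-- `k` is a transition kernel (each row a pmf). -/
def IsKernel {A B : Type*} [Fintype A] [Fintype B] (k : A → B → ℝ) : Prop :=
  ∀ a, IsPMF (k a)

/-- `X — Y — Z` forms a Markov chain (i.e. `X` and `Z` are conditionally
independent given `Y`). -/
def MarkovChain [Fintype Ω] (w : Ω → ℝ) (X : Ω → A) (Y : Ω → B) (Z : Ω → C) : Prop :=
  ∀ a b c,
    distOf w (fun ω => (X ω, Y ω, Z ω)) (a, b, c) * distOf w Y b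
      = distOf w (fun ω => (X ω, Y ω)) (a, b) * distOf w (fun ω => (Z ω, Y ω)) (c, b)

/-- `X` and `Y` are independent. -/
def IndepRV [Fintype Ω] (w : Ω → ℝ) (X : Ω → A) (Y : Ω → B) : Prop :=
  ∀ a b, distOf w (fun ω => (X ω, Y ω)) (a, b) = distOf w X a * distOf w Y b

/-- Number of messages of rate `R` and blocklength `n`: `⌊2^{nR}⌋`. -/
def msgCard (n : ℕ) (R : ℝ) : ℕ := ⌊(2 : ℝ) ^ ((n : ℝ) * R)⌋₊

/-- Binary entropy function. -/
def hb (u : ℝ) : ℝ := -(u * Real.logb 2 u) - (1 - u) * Real.logb 2 (1 - u)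

/-- Empirical frequency of the letter `a` in the sequence `x`. -/
def freqOf {A : Type*} {n : ℕ} (x : Fin n → A) (a : A) : ℝ :=
  ((Finset.univ.filter fun t => x t = a).card : ℝ) / n

/-- `ε`-typicality of a sequence w.r.t. a pmf `P`. -/
def Typical {A : Type*} (ε : ℝ) {n : ℕ} (P : A → ℝ) (x : Fin n → A) : Prop :=
  ∀ a, |freqOf x a - P a| ≤ ε * P a

section NoFB

variable {X Y1 Y2 : Type*} [Fintype X] [Fintype Y1] [Fintype Y2]

/-- Error probability of a blocklength-`n` no-feedback code over the DMBC `W`. -/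
def errProbNoFB (W : X → Y1 × Y2 → ℝ) (n : ℕ) (R0 R1 R2 : ℝ)
    (enc : Fin (msgCard n R0) × Fin (msgCard n R1) × Fin (msgCard n R2) → Fin n → X)
    (dec1 : (Fin n → Y1) → Fin (msgCard n R0) × Fin (msgCard n R1))
    (dec2 : (Fin n → Y2) → Fin (msgCard n R0) × Fin (msgCard n R2)) : ℝ :=
  (1 / ((msgCard n R0 : ℝ) * (msgCard n R1 : ℝ) * (msgCard n R2 : ℝ))) *
    ∑ m : Fin (msgCard n R0) × Fin (msgCard n R1) × Fin (msgCard n R2),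
      ∑ y : Fin n → Y1 × Y2,
        (∏ t, W (enc m t) (y t)) *
          (if dec1 (fun t => (y t).1) ≠ (m.1, m.2.1) ∨ dec2 (fun t => (y t).2) ≠ (m.1, m.2.2)
            then 1 else 0)

/-- Achievability of a rate triple over the DMBC `W` without feedback. -/
def AchievableNoFB (W : X → Y1 × Y2 → ℝ) (R0 R1 R2 : ℝ) : Prop :=
  0 ≤ R0 ∧ 0 ≤ R1 ∧ 0 ≤ R2 ∧
    ∃ enc : (n : ℕ) →
        Fin (msgCard n R0) × Fin (msgCard n R1) × Fin (msgCard n R2) → Fin n → X,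
    ∃ dec1 : (n : ℕ) → (Fin n → Y1) → Fin (msgCard n R0) × Fin (msgCard n R1),
    ∃ dec2 : (n : ℕ) → (Fin n → Y2) → Fin (msgCard n R0) × Fin (msgCard n R2),
      Filter.Tendsto (fun n => errProbNoFB W n R0 R1 R2 (enc n) (dec1 n) (dec2 n))
        Filter.atTop (nhds 0)

/-- The no-feedback capacity region. -/
def CNoFB (W : X → Y1 × Y2 → ℝ) : Set (ℝ × ℝ × ℝ) :=
  closure {r | AchievableNoFB W r.1 r.2.1 r.2.2}

end NoFB

section FB

variable {X Y1 Y2 Yt : Type*} [Fintype X] [Fintype Y1] [Fintype Y2] [Fintype Yt]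

/-- Causality: the time-`t` channel input depends only on feedback symbols before time `t`. -/
def Causal {X Yt : Type*} (n : ℕ) {M : Type*} (enc : Fin n → M → (Fin n → Yt) → X) : Prop :=
  ∀ (t : Fin n) (m : M) (fb fb' : Fin n → Yt),
    (∀ s : Fin n, (s : ℕ) < (t : ℕ) → fb s = fb' s) → enc t m fb = enc t m fb'

/-- Error probability of a blocklength-`n` feedback code over the DMBC with
generalized feedback `W`. -/
def errProbFB (W : X → Y1 × Y2 × Yt → ℝ) (n : ℕ) (R0 R1 R2 : ℝ)
    (enc : Fin n → Fin (msgCard n R0) × Fin (msgCard n R1) × Fin (msgCard n R2) →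
      (Fin n → Yt) → X)
    (dec1 : (Fin n → Y1) → Fin (msgCard n R0) × Fin (msgCard n R1))
    (dec2 : (Fin n → Y2) → Fin (msgCard n R0) × Fin (msgCard n R2)) : ℝ :=
  (1 / ((msgCard n R0 : ℝ) * (msgCard n R1 : ℝ) * (msgCard n R2 : ℝ))) *
    ∑ m : Fin (msgCard n R0) × Fin (msgCard n R1) × Fin (msgCard n R2),
      ∑ y : Fin n → Y1 × Y2 × Yt,
        (∏ t, W (enc t m fun s => (y s).2.2) (y t)) *
          (if dec1 (fun t => (y t).1) ≠ (m.1, m.2.1) ∨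
              dec2 (fun t => (y t).2.1) ≠ (m.1, m.2.2)
            then 1 else 0)

/-- Achievability of a rate triple over the DMBC with generalized feedback `W`. -/
def AchievableFB (W : X → Y1 × Y2 × Yt → ℝ) (R0 R1 R2 : ℝ) : Prop :=
  0 ≤ R0 ∧ 0 ≤ R1 ∧ 0 ≤ R2 ∧
    ∃ enc : (n : ℕ) → Fin n →
        Fin (msgCard n R0) × Fin (msgCard n R1) × Fin (msgCard n R2) → (Fin n → Yt) → X,
    ∃ dec1 : (n : ℕ) → (Fin n → Y1) → Fin (msgCard n R0) × Fin (msgCard n R1),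
    ∃ dec2 : (n : ℕ) → (Fin n → Y2) → Fin (msgCard n R0) × Fin (msgCard n R2),
      (∀ n, Causal n (enc n)) ∧
      Filter.Tendsto (fun n => errProbFB W n R0 R1 R2 (enc n) (dec1 n) (dec2 n))
        Filter.atTop (nhds 0)

/-- Capacity region of the DMBC with generalized feedback `W`. -/
def CGenFB (W : X → Y1 × Y2 × Yt → ℝ) : Set (ℝ × ℝ × ℝ) :=
  closure {r | AchievableFB W r.1 r.2.1 r.2.2}

end FB

/-- Extension of a DMBC to a generalized-feedback channel with noiseless feedback
`Ỹ = (Y₁, Y₂)`. -/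
def noiselessExt {X Y1 Y2 : Type*} (W : X → Y1 × Y2 → ℝ) :
    X → Y1 × Y2 × (Y1 × Y2) → ℝ :=
  fun x y => if y.2.2 = (y.1, y.2.1) then W x (y.1, y.2.1) else 0

/-- Capacity region of a DMBC with noiseless feedback. -/
def CNoiselessFB {X Y1 Y2 : Type*} [Fintype X] [Fintype Y1] [Fintype Y2]
    (W : X → Y1 × Y2 → ℝ) : Set (ℝ × ℝ × ℝ) :=
  CGenFB (noiselessExt W)

section Marton

variable {X Y1 Y2 : Type*} [Fintype X] [Fintype Y1] [Fintype Y2]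

/-- The single-letter Marton constraints for the rate triple `(R0,R1,R2)`. -/
def MartonCond (W : X → Y1 × Y2 → ℝ) (R0 R1 R2 : ℝ) : Prop :=
  ∃ (k0 k1 k2 : ℕ) (p : Fin k0 × Fin k1 × Fin k2 → ℝ)
    (f : Fin k0 × Fin k1 × Fin k2 → X), IsPMF p ∧
    (let w : (Fin k0 × Fin k1 × Fin k2) × Y1 × Y2 → ℝ := fun z => p z.1 * W (f z.1) z.2
     let U0 := fun z : (Fin k0 × Fin k1 × Fin k2) × Y1 × Y2 => z.1.1
     let U1 := fun z : (Fin k0 × Fin k1 × Fin k2) × Y1 × Y2 => z.1.2.1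
     let U2 := fun z : (Fin k0 × Fin k1 × Fin k2) × Y1 × Y2 => z.1.2.2
     let Yr1 := fun z : (Fin k0 × Fin k1 × Fin k2) × Y1 × Y2 => z.2.1
     let Yr2 := fun z : (Fin k0 × Fin k1 × Fin k2) × Y1 × Y2 => z.2.2
     R0 < min (miOf w U0 Yr1) (miOf w U0 Yr2) ∧
     R0 + R1 < miOf w (fun z => (U0 z, U1 z)) Yr1 ∧
     R0 + R2 < miOf w (fun z => (U0 z, U2 z)) Yr2 ∧
     R0 + R1 + R2 < cmiOf w U1 Yr1 U0 + cmiOf w U2 Yr2 U0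
       + min (miOf w U0 Yr1) (miOf w U0 Yr2) - cmiOf w U1 U2 U0)

/-- Marton's achievable region for the DMBC `W` without feedback. -/
def MartonRegion (W : X → Y1 × Y2 → ℝ) : Set (ℝ × ℝ × ℝ) :=
  closure {r | 0 ≤ r.1 ∧ 0 ≤ r.2.1 ∧ 0 ≤ r.2.2 ∧ MartonCond W r.1 r.2.1 r.2.2}

end Marton

end BCFB
namespace BCFB

/-- The generalized Dueck DMBC: input `x = (x₁, x₀, x₂)`, outputs
`y₁ = (x₁⊕z₁, x₀⊕z₀)` and `y₂ = (x₀⊕z₀, x₂⊕z₂)` where `(z₀,z₁,z₂) ~ PZ`. -/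
def dueckW (PZ : Bool × Bool × Bool → ℝ) :
    Bool × Bool × Bool → (Bool × Bool) × Bool × Bool → ℝ :=
  fun x y =>
    if y.2.1 = y.1.2 then
      PZ (Bool.xor x.2.1 y.1.2, Bool.xor x.1 y.1.1, Bool.xor x.2.2 y.2.2)
    else 0

/-- The generalized Dueck DMBC with the noisy feedback
`Ỹ = (Y₁₁⊕W₁, Y₁₀⊕W₀, Y₂₂⊕W₂)`, with feedback-noise law `Q` on `(W₀,W₁,W₂)`. -/
def dueckNoisyW (PZ : Bool × Bool × Bool → ℝ) (Q : Bool × Bool × Bool → ℝ) :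
    Bool × Bool × Bool →
      (Bool × Bool) × (Bool × Bool) × (Bool × Bool × Bool) → ℝ :=
  fun x y =>
    dueckW PZ x (y.1, y.2.1) *
      Q (Bool.xor y.2.2.2.1 y.1.2, Bool.xor y.2.2.1 y.1.1, Bool.xor y.2.2.2.2 y.2.1.2)

end BCFB

namespace BCFB

open Filter Topology

theorem sum_prod_pi {ι Λ : Type*} [Fintype ι] [DecidableEq ι] [Fintype Λ] (p : ι → Λ → ℝ) :
    ∑ ω : ι → Λ, ∏ t, p t (ω t) = ∏ t, ∑ l, p t l := by
  rw [Finset.prod_univ_sum, Fintype.piFinset_univ]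

theorem sum_prod_map {ι Λ Γ : Type*} [Fintype ι] [DecidableEq ι] [Fintype Λ] [Fintype Γ]
    (p : ι → Λ → ℝ) (π : Λ → Γ) (G : (ι → Γ) → ℝ) :
    ∑ ω : ι → Λ, (∏ t, p t (ω t)) * G (fun t => π (ω t))
      = ∑ γ : ι → Γ, (∏ t, ∑ l, if π l = γ t then p t l else 0) * G γ := by
  have h : ∀ γ : ι → Γ, (∏ t, ∑ l, if π l = γ t then p t l else 0) * G γ
      = ∑ ω : ι → Λ, if (fun t => π (ω t)) = γ then (∏ t, p t (ω t)) * G γ else 0 := by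
    intro γ
    rw [← sum_prod_pi (fun t l => if π l = γ t then p t l else 0), Finset.sum_mul]
    refine Finset.sum_congr rfl fun ω _ => ?_
    rw [Finset.prod_ite_zero]
    simp only [Finset.mem_univ, true_imp_iff, funext_iff, ite_mul, zero_mul]
  simp_rw [h]
  rw [Finset.sum_comm]
  refine Finset.sum_congr rfl fun ω _ => ?_
  rw [Finset.sum_ite_eq]
  simp

theorem prOf_or_le {Ω : Type*} [Fintype Ω] {w : Ω → ℝ} (hw : ∀ ω, 0 ≤ w ω) (E F : Ω → Prop) :
    prOf w (fun ω => E ω ∨ F ω) ≤ prOf w E + prOf w F := by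
  unfold prOf
  rw [← Finset.sum_add_distrib]
  refine Finset.sum_le_sum fun ω _ => ?_
  have := hw ω
  by_cases hE : E ω <;> by_cases hF : F ω <;> simp [hE, hF, this]

/-- Chernoff bound for a product law. -/
theorem prOf_sum_ge_le {ι Λ : Type*} [Fintype ι] [DecidableEq ι] [Fintype Λ] (p : ι → Λ → ℝ)
    (hp : ∀ t l, 0 ≤ p t l) (f : ι → Λ → ℝ) {s : ℝ} (hs : 0 < s) (a : ℝ) :
    prOf (fun ω : ι → Λ => ∏ t, p t (ω t)) (fun ω => a ≤ ∑ t, f t (ω t))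
      ≤ (2 : ℝ) ^ (-(s * a)) * ∏ t, ∑ l, p t l * (2 : ℝ) ^ (s * f t l) := by
  rw [← sum_prod_pi (fun t l => p t l * (2 : ℝ) ^ (s * f t l)), Finset.mul_sum]
  refine Finset.sum_le_sum fun ω _ => ?_
  have h0 : 0 ≤ ∏ t, p t (ω t) := Finset.prod_nonneg fun t _ => hp _ _
  rw [Finset.prod_mul_distrib, ← Real.rpow_sum_of_pos (by norm_num), ← Finset.mul_sum,
    mul_left_comm, ← Real.rpow_add (by norm_num)]
  split_ifs with h
  · refine le_mul_of_one_le_right h0 (Real.one_le_rpow (by norm_num) ?_)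
    nlinarith
  · positivity

theorem eventually_mgf_le {Λ : Type*} [Fintype Λ] {p : Λ → ℝ} (hp : ∑ l, p l = 1)
    (f : Λ → ℝ) {c : ℝ} (hc : ∑ l, p l * f l < c) :
    ∀ᶠ s in 𝓝[>] (0 : ℝ), ∑ l, p l * (2 : ℝ) ^ (s * f l) ≤ (2 : ℝ) ^ (s * c) := by
  have hd : ∀ a : ℝ, HasDerivAt (fun s : ℝ => (2 : ℝ) ^ (s * a)) (Real.log 2 * a) 0 := by
    intro a
    have := ((hasDerivAt_id (0 : ℝ)).mul_const a).const_rpow (a := 2) (by norm_num)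
    simpa using this
  have h1 : HasDerivAt (fun s : ℝ => ∑ l, p l * (2 : ℝ) ^ (s * f l) - (2 : ℝ) ^ (s * c))
      (∑ l, p l * (Real.log 2 * f l) - Real.log 2 * c) 0 :=
    (HasDerivAt.fun_sum fun l _ => (hd (f l)).const_mul (p l)).sub (hd c)
  have hneg : ∑ l, p l * (Real.log 2 * f l) - Real.log 2 * c < 0 := by
    have : ∑ l, p l * (Real.log 2 * f l) = Real.log 2 * ∑ l, p l * f l := by
      rw [Finset.mul_sum]; exact Finset.sum_congr rfl fun l _ => by ring
    rw [this]
    have := Real.log_pos (by norm_num : (1 : ℝ) < 2)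
    nlinarith
  rw [hasDerivAt_iff_tendsto_slope] at h1
  have h2 := h1.eventually (eventually_lt_nhds hneg)
  have h3 : ∀ᶠ s in 𝓝[>] (0 : ℝ), slope (fun s : ℝ => ∑ l, p l * (2 : ℝ) ^ (s * f l)
      - (2 : ℝ) ^ (s * c)) 0 s < 0 :=
    h2.filter_mono (nhdsWithin_mono _ fun x hx => ne_of_gt hx)
  filter_upwards [h3, self_mem_nhdsWithin] with s hs hs0
  rw [slope_def_field] at hs
  have hs0' : (0 : ℝ) < s := hs0
  simp only [zero_mul, Real.rpow_zero, mul_one, hp, sub_self, sub_zero] at hs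
  rw [div_lt_iff₀ hs0'] at hs
  linarith

theorem card_hom_eq_zero {U : Type*} [AddCommGroup U] [Fintype U] [Fintype (U →+ Bool)] {v : U}
    {φ : U →+ Bool} (hφ : φ v = 1) :
    (∑ a : U →+ Bool, if a v = 0 then (1 : ℝ) else 0) * 2 = Fintype.card (U →+ Bool) := by
  have h1 : (∑ a : U →+ Bool, if a v = 0 then (1 : ℝ) else 0)
      = ∑ a : U →+ Bool, if a v = 0 then 0 else 1 := by
    rw [← Equiv.sum_comp (Equiv.addRight φ)]
    refine Finset.sum_congr rfl fun a _ => ?_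
    have : (Equiv.addRight φ a) v = a v + 1 := by simp [hφ]
    rw [this]
    rcases h : a v <;> rfl
  have h2 : (∑ a : U →+ Bool, if a v = 0 then (1 : ℝ) else 0)
      + (∑ a : U →+ Bool, if a v = 0 then (0 : ℝ) else 1) = Fintype.card (U →+ Bool) := by
    rw [← Finset.sum_add_distrib, Fintype.card_eq_sum_ones]
    push_cast
    refine Finset.sum_congr rfl fun a _ => ?_
    split_ifs <;> norm_num
  linarith

/-- Random linear hashing: a hash with `r` bits resolves a vector lying, given the side
information, in a list of size at most `B`. -/
theorem exists_hash {U S Ω : Type*} [AddCommGroup U] [Fintype U] [Fintype Ω]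
    (hsep : ∀ v : U, v ≠ 0 → ∃ φ : U →+ Bool, φ v = 1)
    (w : Ω → ℝ) (hw : IsPMF w) (s : Ω → S) (v : Ω → U) (T : S → U → Prop) (B : ℝ)
    (hB : ∀ σ, ((Finset.univ.filter fun u => T σ u).card : ℝ) ≤ B) (r : ℕ) :
    ∃ (A : U →+ (Fin r → Bool)) (D : S → (Fin r → Bool) → U),
      prOf w (fun ω => D (s ω) (A (v ω)) ≠ v ω)
        ≤ prOf w (fun ω => ¬ T (s ω) (v ω)) + B / 2 ^ r := by
  have : Finite (U →+ Bool) := DFunLike.finite _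
  have : Fintype (U →+ Bool) := Fintype.ofFinite _
  let F : (Fin r → (U →+ Bool)) → ℝ := fun a =>
    ∑ ω, w ω * ∑ u, if u ≠ v ω ∧ T (s ω) u ∧ ∀ i, a i (u - v ω) = 0 then (1 : ℝ) else 0
  have hcount : ∀ x : U, x ≠ 0 → (∑ a : Fin r → (U →+ Bool), if ∀ i, a i x = 0 then (1 : ℝ) else 0)
      = (Fintype.card (U →+ Bool) : ℝ) ^ r / 2 ^ r := by
    intro x hx
    obtain ⟨φ, hφ⟩ := hsep x hx
    have h := card_hom_eq_zero hφ
    have h2 := sum_prod_pi (fun (_ : Fin r) (a : U →+ Bool) => if a x = 0 then (1 : ℝ) else 0)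
    rw [Finset.prod_const, Finset.card_univ, Fintype.card_fin] at h2
    rw [← div_pow, ← h, mul_div_assoc, div_self (by norm_num), mul_one, ← h2]
    refine Finset.sum_congr rfl fun a _ => ?_
    rw [Finset.prod_ite_zero]
    simp
  have hFsum : ∑ a, F a ≤ ∑ a : Fin r → (U →+ Bool), B / 2 ^ r := by
    have hc : (∑ a : Fin r → (U →+ Bool), B / 2 ^ r)
        = (Fintype.card (U →+ Bool) : ℝ) ^ r / 2 ^ r * B := by
      rw [Finset.sum_const, Finset.card_univ, Fintype.card_fun, Fintype.card_fin]
      simp; ring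
    rw [hc]
    simp only [F]
    rw [Finset.sum_comm]
    calc _ = ∑ ω, w ω * ∑ u, ∑ a : Fin r → (U →+ Bool),
            (if u ≠ v ω ∧ T (s ω) u ∧ ∀ i, a i (u - v ω) = 0 then (1 : ℝ) else 0) := by
          refine Finset.sum_congr rfl fun ω _ => ?_
          rw [← Finset.mul_sum, Finset.sum_comm]
      _ ≤ ∑ ω, w ω * ((Fintype.card (U →+ Bool) : ℝ) ^ r / 2 ^ r * B) := by
          refine Finset.sum_le_sum fun ω _ => mul_le_mul_of_nonneg_left ?_ (hw.1 ω)
          calc _ ≤ ∑ u, if T (s ω) u then (Fintype.card (U →+ Bool) : ℝ) ^ r / 2 ^ r else 0 := by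
                refine Finset.sum_le_sum fun u _ => ?_
                by_cases hu : u ≠ v ω ∧ T (s ω) u
                · rw [if_pos hu.2, ← hcount _ (sub_ne_zero.2 hu.1)]
                  refine le_of_eq (Finset.sum_congr rfl fun a _ => ?_)
                  simp [hu.1, hu.2]
                · have : ∀ a : Fin r → (U →+ Bool), ¬ (u ≠ v ω ∧ T (s ω) u ∧
                      ∀ i, a i (u - v ω) = 0) := fun a ha => hu ⟨ha.1, ha.2.1⟩
                  simp only [this, if_false, Finset.sum_const_zero]
                  split_ifs <;> positivity
            _ = (Fintype.card (U →+ Bool) : ℝ) ^ r / 2 ^ r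
                  * (Finset.univ.filter fun u => T (s ω) u).card := by
                rw [← Finset.sum_filter, Finset.sum_const, nsmul_eq_mul, mul_comm]
            _ ≤ _ := mul_le_mul_of_nonneg_left (hB _) (by positivity)
      _ = _ := by rw [← Finset.sum_mul, hw.2, one_mul]
  obtain ⟨a, -, ha⟩ := Finset.exists_le_of_sum_le
    (Finset.univ_nonempty (α := Fin r → (U →+ Bool))) hFsum
  let A : U →+ (Fin r → Bool) := AddMonoidHom.pi a
  refine ⟨A, fun σ b => if h : ∃ u, T σ u ∧ A u = b then h.choose else 0, ?_⟩
  refine le_trans ?_ (add_le_add_right ha _)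
  simp only [prOf, F]
  rw [← Finset.sum_add_distrib]
  refine Finset.sum_le_sum fun ω _ => ?_
  have hnn : ∀ u, 0 ≤ (if u ≠ v ω ∧ T (s ω) u ∧ ∀ i, a i (u - v ω) = 0 then (1 : ℝ) else 0) :=
    fun u => by split_ifs <;> norm_num
  have h0 : 0 ≤ w ω * ∑ u, (if u ≠ v ω ∧ T (s ω) u ∧ ∀ i, a i (u - v ω) = 0
      then (1 : ℝ) else 0) := mul_nonneg (hw.1 ω) (Finset.sum_nonneg fun u _ => hnn u)
  by_cases hT : T (s ω) (v ω)
  · have hex : ∃ u, T (s ω) u ∧ A u = A (v ω) := ⟨_, hT, rfl⟩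
    rw [if_neg (not_not.2 hT), zero_add]
    split_ifs with hne
    · have hs := hex.choose_spec
      refine le_mul_of_one_le_right (hw.1 ω) ?_
      refine le_trans ?_ (Finset.single_le_sum (fun u _ => hnn u) (Finset.mem_univ hex.choose))
      rw [if_pos]
      refine ⟨hne, hs.1, fun i => ?_⟩
      have := congrFun hs.2 i
      simp only [A, AddMonoidHom.pi_apply] at this
      rw [map_sub, this, sub_self]
    · exact h0
  · rw [if_pos hT]
    have := hw.1 ω
    split_ifs <;> linarith

/-- Every hash has a large kernel, even among vectors vanishing outside a set `E`. -/
theorem exists_injective_ker {ι M : Type*} [Fintype ι] [DecidableEq ι] [Fintype M] {r : ℕ} (E : ι → Prop) [DecidablePred E]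
    (A : (ι → Bool) →+ (Fin r → Bool))
    (h : Fintype.card M * 2 ^ r ≤ 2 ^ (Finset.univ.filter E).card) :
    ∃ c : M → ι → Bool, Function.Injective c ∧ (∀ m, A (c m) = 0) ∧ ∀ m t, ¬ E t → c m t = 0 := by
  let S : Finset (ι → Bool) := Fintype.piFinset fun t => if E t then Finset.univ else {0}
  have hS : ∀ x, x ∈ S ↔ ∀ t, ¬ E t → x t = 0 := by
    intro x
    simp only [S, Fintype.mem_piFinset]
    refine forall_congr' fun t => ?_
    by_cases ht : E t <;> simp [ht]
  have hcard : S.card = 2 ^ (Finset.univ.filter E).card := by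
    simp only [S, Fintype.card_piFinset]
    rw [Finset.prod_congr rfl (g := fun t => if E t then 2 else 1)
      (fun t _ => by split_ifs <;> simp), Finset.prod_ite]
    simp
  obtain ⟨b, -, hb⟩ := Finset.exists_le_card_fiber_of_mul_le_card_of_maps_to
    (s := S) (t := (Finset.univ : Finset (Fin r → Bool))) (f := A) (n := Fintype.card M)
    (fun _ _ => Finset.mem_univ _) Finset.univ_nonempty (by
      rw [hcard, Finset.card_univ, Fintype.card_fun, Fintype.card_fin, Fintype.card_bool, mul_comm]
      exact h)
  by_cases hM : IsEmpty M
  · exact ⟨fun m => hM.elim m, fun m => hM.elim m, fun m => hM.elim m, fun m => hM.elim m⟩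
  rw [not_isEmpty_iff] at hM
  have hne : (S.filter fun x => A x = b).Nonempty := by
    rw [← Finset.card_pos]
    exact lt_of_lt_of_le Fintype.card_pos hb
  obtain ⟨x0, hx0⟩ := hne
  have hemb : Nonempty (M ↪ (S.filter fun x => A x = b)) :=
    Function.Embedding.nonempty_of_card_le (by rwa [Fintype.card_coe])
  obtain ⟨e⟩ := hemb
  rw [Finset.mem_filter, hS] at hx0
  have he : ∀ m, (∀ t, ¬ E t → (e m).1 t = 0) ∧ A (e m).1 = b := fun m => by
    have := (e m).2
    rwa [Finset.mem_filter, hS] at this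
  refine ⟨fun m => (e m).1 - x0, fun m m' hmm => e.injective (Subtype.ext ?_), fun m => ?_,
    fun m t ht => ?_⟩
  · exact sub_left_injective hmm
  · rw [map_sub, (he m).2, hx0.2, sub_self]
  · simp [(he m).1 t ht, hx0.1 t ht]

theorem tendsto_two_rpow_linear {a : ℝ} (ha : a < 0) (b : ℝ) :
    Tendsto (fun N : ℕ => (2 : ℝ) ^ ((N : ℝ) * a + b)) atTop (𝓝 0) := by
  have h : ∀ N : ℕ, (2 : ℝ) ^ ((N : ℝ) * a + b) = ((2 : ℝ) ^ a) ^ N * (2 : ℝ) ^ b := by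
    intro N
    rw [Real.rpow_add (by norm_num), mul_comm (N : ℝ), Real.rpow_mul (by norm_num),
      Real.rpow_natCast]
  simp_rw [h]
  have := tendsto_pow_atTop_nhds_zero_of_lt_one (r := (2 : ℝ) ^ a) (by positivity)
    (Real.rpow_lt_one_of_one_lt_of_neg (by norm_num) ha)
  simpa using this.mul_const ((2 : ℝ) ^ b)

theorem isPMF_prod {ι Λ : Type*} [Fintype ι] [DecidableEq ι] [Fintype Λ] {p : ι → Λ → ℝ}
    (hp : ∀ t, IsPMF (p t)) : IsPMF (fun ω : ι → Λ => ∏ t, p t (ω t)) := by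
  refine ⟨fun ω => Finset.prod_nonneg fun t _ => (hp t).1 _, ?_⟩
  rw [sum_prod_pi]
  exact Finset.prod_eq_one fun t _ => (hp t).2

/-- At most `2 ^ a` sequences have likelihood at least `2 ^ (-a)`. -/
theorem card_likelihood_ge_le {ι V : Type*} [Fintype ι] [DecidableEq ι] [Fintype V]
    (κ : ι → V → ℝ) (h0 : ∀ t v, 0 ≤ κ t v) (h1 : ∀ t, ∑ v, κ t v ≤ 1) (a : ℝ) :
    ((Finset.univ.filter fun u : ι → V => (2 : ℝ) ^ (-a) ≤ ∏ t, κ t (u t)).card : ℝ)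
      ≤ (2 : ℝ) ^ a := by
  have h : ((Finset.univ.filter fun u : ι → V => (2 : ℝ) ^ (-a) ≤ ∏ t, κ t (u t)).card : ℝ)
      * (2 : ℝ) ^ (-a) ≤ 1 := by
    rw [← nsmul_eq_mul]
    calc _ ≤ ∑ u ∈ Finset.univ.filter fun u : ι → V => (2 : ℝ) ^ (-a) ≤ ∏ t, κ t (u t),
          ∏ t, κ t (u t) :=
          Finset.card_nsmul_le_sum _ _ _ fun u hu => (Finset.mem_filter.1 hu).2
      _ ≤ ∑ u : ι → V, ∏ t, κ t (u t) :=
          Finset.sum_le_sum_of_subset_of_nonneg (Finset.filter_subset _ _)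
            fun u _ _ => Finset.prod_nonneg fun t _ => h0 _ _
      _ ≤ 1 := by
          rw [sum_prod_pi]
          exact Finset.prod_le_one (fun t _ => Finset.sum_nonneg fun v _ => h0 _ _)
            fun t _ => h1 t
  have h2 := mul_le_mul_of_nonneg_right h (by positivity : 0 ≤ (2 : ℝ) ^ a)
  rwa [mul_assoc, ← Real.rpow_add (by norm_num), neg_add_cancel, Real.rpow_zero, mul_one,
    one_mul] at h2

theorem sum_phase {N k : ℕ} (hk : k ≤ N) (a b : ℝ) :
    ∑ t : Fin N, (if (t : ℕ) < k then a else b) = k * a + (N - k) * b := by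
  have h : (Finset.univ.filter fun t : Fin N => (t : ℕ) < k).card = k := by
    rw [Fin.card_filter_val_lt, min_eq_right hk]
  have h2 : ∀ t : Fin N, (if (t : ℕ) < k then a else b) = b + if (t : ℕ) < k then a - b else 0 :=
    fun t => by split_ifs <;> ring
  simp_rw [h2]
  rw [Finset.sum_add_distrib, ← Finset.sum_filter, Finset.sum_const, Finset.sum_const, h,
    Finset.card_univ, Fintype.card_fin, nsmul_eq_mul, nsmul_eq_mul]
  ring

theorem floor_mul_le {α : ℝ} (h1 : α ≤ 1) (N : ℕ) : ⌊α * N⌋₊ ≤ N := by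
  refine Nat.floor_le_of_le ?_
  nlinarith [(Nat.cast_nonneg N : (0 : ℝ) ≤ N)]

theorem phase_cost_le {α : ℝ} (h0 : 0 ≤ α) (N : ℕ) (a b : ℝ) :
    (⌊α * N⌋₊ : ℝ) * a + ((N : ℝ) - ⌊α * N⌋₊) * b ≤ N * (α * a + (1 - α) * b) + |a - b| := by
  have hf := Nat.floor_le (by positivity : 0 ≤ α * (N : ℝ))
  have hf2 := (Nat.lt_floor_add_one (α * (N : ℝ))).le
  have h : (⌊α * N⌋₊ - α * N : ℝ) * (a - b) ≤ |a - b| := by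
    refine (le_abs_self _).trans ?_
    rw [abs_mul]
    refine mul_le_of_le_one_left (abs_nonneg _) ?_
    rw [abs_le]; constructor <;> linarith
  linarith [h]

/-- Almost lossless hashing of a memoryless source with side information whose statistics change
once, after a fraction `α` of the block. -/
theorem exists_phase_hash {Λ S V : Type*} [Fintype Λ] [AddCommGroup V] [Fintype V]
    (hsep : ∀ v : V, v ≠ 0 → ∃ φ : V →+ Bool, φ v = 1)
    (p : Λ → ℝ) (hp : IsPMF p) (s : Λ → S) (uA uB : Λ → V) (κA κB : S → V → ℝ)
    (hA0 : ∀ σ v, 0 ≤ κA σ v) (hB0 : ∀ σ v, 0 ≤ κB σ v)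
    (hA1 : ∀ σ, ∑ v, κA σ v ≤ 1) (hB1 : ∀ σ, ∑ v, κB σ v ≤ 1)
    (hA : ∀ l, 0 < p l → 0 < κA (s l) (uA l)) (hB : ∀ l, 0 < p l → 0 < κB (s l) (uB l))
    {cA cB α c : ℝ}
    (hcA : ∑ l, p l * -Real.logb 2 (κA (s l) (uA l)) < cA)
    (hcB : ∑ l, p l * -Real.logb 2 (κB (s l) (uB l)) < cB)
    (hα0 : 0 ≤ α) (hα1 : α ≤ 1) (hc : α * cA + (1 - α) * cB < c) :
    ∃ e : ℕ → ℝ, Tendsto e atTop (𝓝 0) ∧ ∀ N : ℕ,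
      ∃ (A : (Fin N → V) →+ (Fin ⌈N * c⌉₊ → Bool)) (D : (Fin N → S) → (Fin ⌈N * c⌉₊ → Bool) →
          (Fin N → V)),
        prOf (fun ω : Fin N → Λ => ∏ t, p (ω t)) (fun ω =>
          D (fun t => s (ω t)) (A fun t : Fin N => if (t : ℕ) < ⌊α * N⌋₊ then uA (ω t) else uB (ω t))
            ≠ fun t : Fin N => if (t : ℕ) < ⌊α * N⌋₊ then uA (ω t) else uB (ω t)) ≤ e N := by
  obtain ⟨s0, ⟨hsA, hsB⟩, hs0⟩ := (((eventually_mgf_le hp.2 _ hcA).and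
    (eventually_mgf_le hp.2 _ hcB)).and self_mem_nhdsWithin).exists
  replace hs0 : 0 < s0 := hs0
  obtain ⟨d, hd1, hd2⟩ := exists_between hc
  refine ⟨fun N => (2 : ℝ) ^ ((N : ℝ) * (s0 * (α * cA + (1 - α) * cB - d)) + s0 * |cA - cB|)
    + (2 : ℝ) ^ ((N : ℝ) * (d - c) + 0), ?_, fun N => ?_⟩
  · have := (tendsto_two_rpow_linear (a := s0 * (α * cA + (1 - α) * cB - d)) (by nlinarith)
      (s0 * |cA - cB|)).add (tendsto_two_rpow_linear (a := d - c) (by linarith) 0)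
    simpa using this
  set k := ⌊α * N⌋₊ with hk
  have hkN : k ≤ N := floor_mul_le hα1 N
  let κ : Fin N → S → V → ℝ := fun t => if (t : ℕ) < k then κA else κB
  let u : Fin N → Λ → V := fun t => if (t : ℕ) < k then uA else uB
  have hκ0 : ∀ t σ v, 0 ≤ κ t σ v := fun t σ v => by
    simp only [κ]; split_ifs
    exacts [hA0 _ _, hB0 _ _]
  have hκ1 : ∀ t σ, ∑ v, κ t σ v ≤ 1 := fun t σ => by
    simp only [κ]; split_ifs
    exacts [hA1 _, hB1 _]
  have hpos : ∀ t l, 0 < p l → 0 < κ t (s l) (u t l) := fun t l hl => by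
    simp only [κ, u]; split_ifs
    exacts [hA _ hl, hB _ hl]
  have hu : ∀ ω : Fin N → Λ, (fun t : Fin N => if (t : ℕ) < k then uA (ω t) else uB (ω t))
      = fun t => u t (ω t) := fun ω => by
    funext t; simp only [u]; split_ifs <;> rfl
  have hsepU : ∀ v : Fin N → V, v ≠ 0 → ∃ φ : (Fin N → V) →+ Bool, φ v = 1 := by
    intro v hv
    obtain ⟨t, ht⟩ := Function.ne_iff.1 hv
    obtain ⟨φ, hφ⟩ := hsep (v t) ht
    exact ⟨φ.comp (Pi.evalAddMonoidHom _ t), hφ⟩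
  obtain ⟨A, D, hAD⟩ := exists_hash hsepU (fun ω : Fin N → Λ => ∏ t, p (ω t))
    (isPMF_prod fun _ => hp) (fun ω t => s (ω t)) (fun ω t => u t (ω t))
    (fun σ v => (2 : ℝ) ^ (-(N * d)) ≤ ∏ t, κ t (σ t) (v t)) ((2 : ℝ) ^ (N * d))
    (fun σ => card_likelihood_ge_le (fun t => κ t (σ t)) (fun t => hκ0 t _) (fun t => hκ1 t _) _)
    ⌈N * c⌉₊
  refine ⟨A, D, ?_⟩
  simp_rw [hu]
  refine hAD.trans (add_le_add ?_ ?_)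
  · let f : Fin N → Λ → ℝ := fun t l => -Real.logb 2 (κ t (s l) (u t l))
    have h1 := prOf_sum_ge_le (fun _ : Fin N => p) (fun _ => hp.1) f hs0 (N * d)
    have h2 : prOf (fun ω : Fin N → Λ => ∏ t, p (ω t))
        (fun ω => ¬ (2 : ℝ) ^ (-(N * d)) ≤ ∏ t, κ t (s (ω t)) (u t (ω t)))
        ≤ prOf (fun ω : Fin N → Λ => ∏ t, p (ω t)) (fun ω => N * d ≤ ∑ t, f t (ω t)) := by
      refine Finset.sum_le_sum fun ω _ => ?_
      by_cases hz : ∏ t, p (ω t) = 0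
      · simp [hz]
      have hpz : ∀ t, 0 < p (ω t) := fun t =>
        lt_of_le_of_ne (hp.1 _) (Ne.symm (Finset.prod_ne_zero_iff.1 hz t (Finset.mem_univ _)))
      by_cases hE : N * d ≤ ∑ t, f t (ω t)
      · rw [if_pos hE]
        split_ifs
        exacts [le_rfl, Finset.prod_nonneg fun t _ => hp.1 _]
      · rw [if_neg hE, if_neg]
        rw [not_not]
        have hprod : ∏ t, κ t (s (ω t)) (u t (ω t)) = (2 : ℝ) ^ (-∑ t, f t (ω t)) := by
          rw [← Finset.sum_neg_distrib, Real.rpow_sum_of_pos (by norm_num)]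
          refine Finset.prod_congr rfl fun t _ => ?_
          simp only [f, neg_neg]
          rw [Real.rpow_logb (by norm_num) (by norm_num) (hpos t _ (hpz t))]
        rw [hprod]
        refine Real.rpow_le_rpow_of_exponent_le (by norm_num) ?_
        linarith [not_le.1 hE]
    refine h2.trans (h1.trans ?_)
    have h3 : ∏ t : Fin N, ∑ l, p l * (2 : ℝ) ^ (s0 * f t l)
        ≤ ∏ t : Fin N, (2 : ℝ) ^ (s0 * (if (t : ℕ) < k then cA else cB)) := by
      refine Finset.prod_le_prod (fun t _ => Finset.sum_nonneg fun l _ =>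
        mul_nonneg (hp.1 _) (by positivity)) fun t _ => ?_
      simp only [f, κ, u]
      split_ifs
      exacts [hsA, hsB]
    rw [← Real.rpow_sum_of_pos (by norm_num), ← Finset.mul_sum, sum_phase hkN] at h3
    refine (mul_le_mul_of_nonneg_left h3 (by positivity)).trans ?_
    rw [← Real.rpow_add (by norm_num)]
    refine Real.rpow_le_rpow_of_exponent_le (by norm_num) ?_
    have := phase_cost_le hα0 N cA cB
    nlinarith [mul_le_mul_of_nonneg_left this hs0.le]
  · rw [← Real.rpow_natCast 2, ← Real.rpow_sub (by norm_num)]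
    refine Real.rpow_le_rpow_of_exponent_le (by norm_num) ?_
    have := Nat.le_ceil ((N : ℝ) * c)
    linarith

theorem separating_bool : ∀ v : Bool, v ≠ 0 → ∃ φ : Bool →+ Bool, φ v = 1 := by
  intro v hv
  refine ⟨AddMonoidHom.id _, ?_⟩
  cases v
  · exact absurd rfl hv
  · rfl

theorem separating_bool_prod : ∀ v : Bool × Bool, v ≠ 0 → ∃ φ : Bool × Bool →+ Bool, φ v = 1 := by
  rintro ⟨a, b⟩ hv
  cases a
  · refine ⟨AddMonoidHom.snd _ _, ?_⟩
    cases b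
    · exact absurd rfl hv
    · rfl
  · exact ⟨AddMonoidHom.fst _ _, rfl⟩

/-- The channel noise `(Z₀, Z₁, Z₂)` and feedback noise `(W₀, W₁, W₂)` behind a channel input and
the corresponding outputs. -/
def noiseOf (x : Bool × Bool × Bool) (y : (Bool × Bool) × (Bool × Bool) × (Bool × Bool × Bool)) :
    (Bool × Bool × Bool) × (Bool × Bool × Bool) :=
  ((Bool.xor x.2.1 y.1.2, Bool.xor x.1 y.1.1, Bool.xor x.2.2 y.2.1.2),
    (Bool.xor y.2.2.2.1 y.1.2, Bool.xor y.2.2.1 y.1.1, Bool.xor y.2.2.2.2 y.2.1.2))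

theorem noiseOf_injOn {x : Bool × Bool × Bool}
    {y y' : (Bool × Bool) × (Bool × Bool) × (Bool × Bool × Bool)}
    (hy : y.2.1.1 = y.1.2) (hy' : y'.2.1.1 = y'.1.2) (h : noiseOf x y = noiseOf x y') : y = y' := by
  obtain ⟨⟨a1, a0⟩, ⟨b0, b2⟩, c1, c0, c2⟩ := y
  obtain ⟨⟨a1', a0'⟩, ⟨b0', b2'⟩, c1', c0', c2'⟩ := y'
  simp only [noiseOf, Prod.mk.injEq] at h hy hy' ⊢
  obtain ⟨⟨h1, h2, h3⟩, h4, h5, h6⟩ := h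
  rw [Bool.xor_right_inj] at h1 h2 h3
  subst h1 h2 h3 hy hy'
  rw [Bool.xor_left_inj] at h4 h5 h6
  simp [h4, h5, h6]

theorem dueckNoisyW_eq (P Q : Bool × Bool × Bool → ℝ) (x : Bool × Bool × Bool)
    (y : (Bool × Bool) × (Bool × Bool) × (Bool × Bool × Bool)) :
    dueckNoisyW P Q x y
      = if y.2.1.1 = y.1.2 then P (noiseOf x y).1 * Q (noiseOf x y).2 else 0 := by
  simp only [dueckNoisyW, dueckW, noiseOf]
  split_ifs <;> simp

/-- A feedback code errs with at most the probability of a set of noise sequences outside of which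
it always decodes correctly. -/
theorem errProbFB_dueck_le {P Q : Bool × Bool × Bool → ℝ} (hP : ∀ z, 0 ≤ P z) (hQ : ∀ z, 0 ≤ Q z)
    (n : ℕ) (R0 R1 R2 : ℝ)
    (enc : Fin n → Fin (msgCard n R0) × Fin (msgCard n R1) × Fin (msgCard n R2) →
      (Fin n → Bool × Bool × Bool) → Bool × Bool × Bool)
    (dec1 : (Fin n → Bool × Bool) → Fin (msgCard n R0) × Fin (msgCard n R1))
    (dec2 : (Fin n → Bool × Bool) → Fin (msgCard n R0) × Fin (msgCard n R2))
    (hc : Causal n enc)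
    (Bad : (Fin n → (Bool × Bool × Bool) × (Bool × Bool × Bool)) → Prop)
    (h : ∀ m (y : Fin n → (Bool × Bool) × (Bool × Bool) × (Bool × Bool × Bool)),
      (∀ t, (y t).2.1.1 = (y t).1.2) →
      ¬ Bad (fun t => noiseOf (enc t m fun s => (y s).2.2) (y t)) →
      dec1 (fun t => (y t).1) = (m.1, m.2.1) ∧ dec2 (fun t => (y t).2.1) = (m.1, m.2.2)) :
    errProbFB (dueckNoisyW P Q) n R0 R1 R2 enc dec1 dec2
      ≤ prOf (fun ω : Fin n → (Bool × Bool × Bool) × (Bool × Bool × Bool) =>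
          ∏ t, P (ω t).1 * Q (ω t).2) Bad := by
  have hg : ∀ ω : Fin n → (Bool × Bool × Bool) × (Bool × Bool × Bool),
      0 ≤ ∏ t, P (ω t).1 * Q (ω t).2 :=
    fun ω => Finset.prod_nonneg fun t _ => mul_nonneg (hP _) (hQ _)
  have hpr : 0 ≤ prOf (fun ω : Fin n → (Bool × Bool × Bool) × (Bool × Bool × Bool) =>
      ∏ t, P (ω t).1 * Q (ω t).2) Bad :=
    Finset.sum_nonneg fun ω _ => by
      split_ifs
      exacts [hg ω, le_rfl]
  have key : ∀ m, ∑ y : Fin n → (Bool × Bool) × (Bool × Bool) × (Bool × Bool × Bool),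
        (∏ t, dueckNoisyW P Q (enc t m fun s => (y s).2.2) (y t)) *
          (if dec1 (fun t => (y t).1) ≠ (m.1, m.2.1) ∨
              dec2 (fun t => (y t).2.1) ≠ (m.1, m.2.2)
            then (1 : ℝ) else 0)
      ≤ prOf (fun ω : Fin n → (Bool × Bool × Bool) × (Bool × Bool × Bool) =>
          ∏ t, P (ω t).1 * Q (ω t).2) Bad := by
    intro m
    let Θ : (Fin n → (Bool × Bool) × (Bool × Bool) × (Bool × Bool × Bool)) →
        (Fin n → (Bool × Bool × Bool) × (Bool × Bool × Bool)) :=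
      fun y t => noiseOf (enc t m fun s => (y s).2.2) (y t)
    let Cs := Finset.univ.filter
      fun y : Fin n → (Bool × Bool) × (Bool × Bool) × (Bool × Bool × Bool) =>
        (∀ t, (y t).2.1.1 = (y t).1.2) ∧ Bad (Θ y)
    have hinj : Set.InjOn Θ (Cs : Set _) := by
      intro y hy y' hy' hyy
      replace hy := (Finset.mem_filter.1 (Finset.mem_coe.1 hy)).2.1
      replace hy' := (Finset.mem_filter.1 (Finset.mem_coe.1 hy')).2.1
      have hind : ∀ k : ℕ, ∀ t : Fin n, (t : ℕ) = k → y t = y' t := by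
        intro k
        induction k using Nat.strong_induction_on with
        | _ k ih =>
          intro t ht
          have henc : (enc t m fun s => (y s).2.2) = enc t m fun s => (y' s).2.2 :=
            hc t m _ _ fun s hs => by rw [ih s (ht ▸ hs) s rfl]
          have := congrFun hyy t
          simp only [Θ, henc] at this
          exact noiseOf_injOn (hy t) (hy' t) this
      exact funext fun t => hind t t rfl
    calc _ ≤ ∑ y ∈ Cs, ∏ t, P (Θ y t).1 * Q (Θ y t).2 := by
          rw [Finset.sum_filter]
          refine Finset.sum_le_sum fun y _ => ?_
          by_cases hcon : ∀ t, (y t).2.1.1 = (y t).1.2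
          · have hprod : ∏ t, dueckNoisyW P Q (enc t m fun s => (y s).2.2) (y t)
                = ∏ t, P (Θ y t).1 * Q (Θ y t).2 :=
              Finset.prod_congr rfl fun t _ => by rw [dueckNoisyW_eq, if_pos (hcon t)]
            rw [hprod]
            by_cases hb : Bad (Θ y)
            · rw [if_pos (c := _ ∧ _) ⟨hcon, hb⟩]
              refine mul_le_of_le_one_right (hg _) ?_
              split_ifs <;> norm_num
            · have := h m y hcon hb
              simp [this.1, this.2, hb]
          · obtain ⟨t, ht⟩ := not_forall.1 hcon
            rw [Finset.prod_eq_zero (Finset.mem_univ t), zero_mul]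
            · split_ifs
              exacts [hg _, le_rfl]
            · rw [dueckNoisyW_eq, if_neg ht]
      _ = ∑ ω ∈ Cs.image Θ, ∏ t, P (ω t).1 * Q (ω t).2 := (Finset.sum_image
          (f := fun ω : Fin n → (Bool × Bool × Bool) × (Bool × Bool × Bool) =>
            ∏ t, P (ω t).1 * Q (ω t).2) hinj).symm
      _ ≤ ∑ ω ∈ Finset.univ.filter Bad, ∏ t, P (ω t).1 * Q (ω t).2 := by
          refine Finset.sum_le_sum_of_subset_of_nonneg ?_ fun ω _ _ => hg ω
          intro ω hω
          obtain ⟨y, hy, rfl⟩ := Finset.mem_image.1 hω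
          exact Finset.mem_filter.2 ⟨Finset.mem_univ _, (Finset.mem_filter.1 hy).2.2⟩
      _ = _ := by rw [Finset.sum_filter]; rfl
  unfold errProbFB
  refine (mul_le_mul_of_nonneg_left (Finset.sum_le_sum fun m _ => key m) (by positivity)).trans ?_
  rw [Finset.sum_const, Finset.card_univ, Fintype.card_prod, Fintype.card_prod, Fintype.card_fin,
    Fintype.card_fin, Fintype.card_fin, nsmul_eq_mul, ← mul_assoc]
  refine mul_le_of_le_one_left hpr ?_
  push_cast
  rw [← mul_assoc (msgCard n R0 : ℝ), one_div_mul_eq_div]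
  exact div_self_le_one _

/-- Assembling the two-phase feedback scheme at a fixed blocklength from five linear hashes. -/
theorem exists_feedback_code {P Q : Bool × Bool × Bool → ℝ} (hP : ∀ z, 0 ≤ P z) (hQ : ∀ z, 0 ≤ Q z)
    (n k : ℕ) (R0 R1 R2 : ℝ) {ra rb rc r1 r2 : ℕ}
    (A : (Fin n → Bool) →+ (Fin ra → Bool)) (B : (Fin n → Bool) →+ (Fin rb → Bool))
    (C : (Fin n → Bool × Bool) →+ (Fin rc → Bool))
    (E1 : (Fin n → Bool) →+ (Fin r1 → Bool)) (E2 : (Fin n → Bool) →+ (Fin r2 → Bool))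
    (DA : (Fin ra → Bool) → (Fin n → Bool)) (DB : (Fin rb → Bool) → (Fin n → Bool))
    (DC : (Fin n → Bool) → (Fin rc → Bool) → (Fin n → Bool × Bool))
    (D1 : (Fin n → Bool) → (Fin r1 → Bool) → (Fin n → Bool))
    (D2 : (Fin n → Bool) → (Fin r2 → Bool) → (Fin n → Bool))
    (c0 : Fin (msgCard n R0) → Fin n → Bool) (cb : (Fin rc → Bool) → Fin n → Bool)
    (c1 : Fin (msgCard n R1) → Fin n → Bool) (c2 : Fin (msgCard n R2) → Fin n → Bool)
    (hc0 : Function.Injective c0) (hcb : Function.Injective cb) (hc1 : Function.Injective c1)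
    (hc2 : Function.Injective c2)
    (hA : ∀ m, A (c0 m) = 0) (hB : ∀ b, B (cb b) = 0) (hE1 : ∀ m, E1 (c1 m) = 0)
    (hE2 : ∀ m, E2 (c2 m) = 0)
    (hsA : ∀ m (t : Fin n), ¬ (t : ℕ) < k → c0 m t = 0) (hsB : ∀ b (t : Fin n), ¬ ¬ (t : ℕ) < k → cb b t = 0)
    (h0 : 0 < msgCard n R0) (h1 : 0 < msgCard n R1) (h2 : 0 < msgCard n R2) :
    ∃ enc dec1 dec2, Causal n enc ∧
      errProbFB (dueckNoisyW P Q) n R0 R1 R2 enc dec1 dec2 ≤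
        prOf (fun ω : Fin n → (Bool × Bool × Bool) × (Bool × Bool × Bool) =>
            ∏ t, P (ω t).1 * Q (ω t).2)
          (fun ω =>
            DA (A fun t : Fin n => if (t : ℕ) < k then (ω t).1.1 else 0)
                ≠ (fun t : Fin n => if (t : ℕ) < k then (ω t).1.1 else 0) ∨
            DB (B fun t : Fin n => if (t : ℕ) < k then 0 else (ω t).1.1)
                ≠ (fun t : Fin n => if (t : ℕ) < k then 0 else (ω t).1.1) ∨
            DC (fun t => (ω t).1.1) (C fun t : Fin n => if (t : ℕ) < k then
                  ((ω t).1.2.1 + (ω t).2.2.1, (ω t).1.2.2 + (ω t).2.2.2) else 0)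
                ≠ (fun t : Fin n => if (t : ℕ) < k then
                  ((ω t).1.2.1 + (ω t).2.2.1, (ω t).1.2.2 + (ω t).2.2.2) else 0) ∨
            D1 (fun t => (ω t).1.1)
                (E1 fun t : Fin n => if (t : ℕ) < k then (ω t).2.2.1 else (ω t).1.2.1)
                ≠ (fun t : Fin n => if (t : ℕ) < k then (ω t).2.2.1 else (ω t).1.2.1) ∨
            D2 (fun t => (ω t).1.1)
                (E2 fun t : Fin n => if (t : ℕ) < k then (ω t).2.2.2 else (ω t).1.2.2)
                ≠ (fun t : Fin n => if (t : ℕ) < k then (ω t).2.2.2 else (ω t).1.2.2)) := by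
  have : Nonempty (Fin (msgCard n R0)) := ⟨⟨0, h0⟩⟩
  have : Nonempty (Fin (msgCard n R1)) := ⟨⟨0, h1⟩⟩
  have : Nonempty (Fin (msgCard n R2)) := ⟨⟨0, h2⟩⟩
  let fbC : (Fin (msgCard n R0) × Fin (msgCard n R1) × Fin (msgCard n R2)) →
      (Fin n → Bool × Bool × Bool) → Fin n → Bool × Bool := fun m fb t =>
    if (t : ℕ) < k then ((fb t).1 + c1 m.2.1 t, (fb t).2.2 + c2 m.2.2 t) else 0
  let enc : Fin n → Fin (msgCard n R0) × Fin (msgCard n R1) × Fin (msgCard n R2) →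
      (Fin n → Bool × Bool × Bool) → Bool × Bool × Bool := fun t m fb =>
    (c1 m.2.1 t, if (t : ℕ) < k then c0 m.1 t else cb (C (fbC m fb)) t, c2 m.2.2 t)
  let mA : (Fin n → Bool) → Fin n → Bool := fun u t => if (t : ℕ) < k then u t else 0
  let mB : (Fin n → Bool) → Fin n → Bool := fun u t => if (t : ℕ) < k then 0 else u t
  let zA : (Fin n → Bool) → Fin n → Bool := fun u => DA (A (mA u))
  let zB : (Fin n → Bool) → Fin n → Bool := fun u => DB (B (mB u))
  let msg0 : (Fin n → Bool) → Fin (msgCard n R0) := fun u => Function.invFun c0 (mA u + zA u)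
  let fbn : (Fin n → Bool) → Fin n → Bool × Bool := fun u =>
    DC (zA u + zB u) (Function.invFun cb (mB u + zB u))
  let v1 : (Fin n → Bool × Bool) → Fin n → Bool := fun y t => (y t).1 + (fbn (fun t => (y t).2) t).1
  let v2 : (Fin n → Bool × Bool) → Fin n → Bool := fun y t => (y t).2 + (fbn (fun t => (y t).1) t).2
  let dec1 : (Fin n → Bool × Bool) → Fin (msgCard n R0) × Fin (msgCard n R1) := fun y =>
    (msg0 fun t => (y t).2, Function.invFun c1 (v1 y +
      D1 (zA (fun t => (y t).2) + zB fun t => (y t).2) (E1 (v1 y))))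
  let dec2 : (Fin n → Bool × Bool) → Fin (msgCard n R0) × Fin (msgCard n R2) := fun y =>
    (msg0 fun t => (y t).1, Function.invFun c2 (v2 y +
      D2 (zA (fun t => (y t).1) + zB fun t => (y t).1) (E2 (v2 y))))
  have hcausal : Causal n enc := by
    intro t m fb fb' hfb
    simp only [enc]
    by_cases ht : (t : ℕ) < k
    · simp [ht]
    · have : fbC m fb = fbC m fb' := by
        funext s
        simp only [fbC]
        split_ifs with hs
        · rw [hfb s (by omega)]
        · rfl
      rw [this]
  refine ⟨enc, dec1, dec2, hcausal, errProbFB_dueck_le hP hQ n R0 R1 R2 enc dec1 dec2 hcausal _ ?_⟩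
  intro m y hcon hgood
  simp only [not_or, not_not] at hgood
  obtain ⟨gA, gB, gC, g1, g2⟩ := hgood
  set ω : Fin n → (Bool × Bool × Bool) × (Bool × Bool × Bool) :=
    fun t => noiseOf (enc t m fun s => (y s).2.2) (y t) with hω
  let u : Fin n → Bool := fun t => (y t).1.2
  have hcancel : ∀ a b : Bool, a + b + b = a := by decide
  have hA' : mA u = c0 m.1 + fun t : Fin n => if (t : ℕ) < k then (ω t).1.1 else 0 := by
    funext t
    simp only [mA, u, Pi.add_apply]
    split_ifs with ht
    · simp only [hω, noiseOf, enc, if_pos ht]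
      generalize c0 m.1 t = a; generalize (y t).1.2 = b; revert a b; decide
    · rw [hsA _ _ ht]; rfl
  have hzA : zA u = fun t : Fin n => if (t : ℕ) < k then (ω t).1.1 else 0 := by
    simp only [zA]
    rw [hA', map_add, hA, zero_add, gA]
  have hm0 : msg0 u = m.1 := by
    simp only [msg0]
    have : mA u + zA u = c0 m.1 := by
      rw [hzA, hA']; funext t; exact hcancel _ _
    rw [this, Function.leftInverse_invFun hc0]
  have hB' : mB u = cb (C (fbC m fun s => (y s).2.2)) +
      fun t : Fin n => if (t : ℕ) < k then 0 else (ω t).1.1 := by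
    funext t
    simp only [mB, u, Pi.add_apply]
    split_ifs with ht
    · rw [hsB _ _ (not_not.2 ht)]; rfl
    · simp only [hω, noiseOf, enc, if_neg ht]
      generalize cb _ t = a; generalize (y t).1.2 = b; revert a b; decide
  have hzB : zB u = fun t : Fin n => if (t : ℕ) < k then 0 else (ω t).1.1 := by
    simp only [zB]
    rw [hB', map_add, hB, zero_add, gB]
  have hz : zA u + zB u = fun t => (ω t).1.1 := by
    rw [hzA, hzB]; funext t
    simp only [Pi.add_apply]
    split_ifs
    · exact add_zero _
    · exact zero_add _
  have hfb : (fbC m fun s => (y s).2.2) = fun t : Fin n => if (t : ℕ) < k then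
      ((ω t).1.2.1 + (ω t).2.2.1, (ω t).1.2.2 + (ω t).2.2.2) else 0 := by
    funext t
    simp only [fbC]
    split_ifs with ht
    · simp only [hω, noiseOf, enc]
      generalize c1 m.2.1 t = a; generalize c2 m.2.2 t = b
      generalize (y t).1.1 = d; generalize (y t).2.1.2 = e
      generalize (y t).2.2.1 = f; generalize (y t).2.2.2.2 = g
      revert a b d e f g; decide
    · rfl
  have hfbn : fbn u = fun t : Fin n => if (t : ℕ) < k then
      ((ω t).1.2.1 + (ω t).2.2.1, (ω t).1.2.2 + (ω t).2.2.2) else 0 := by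
    have : mB u + zB u = cb (C (fbC m fun s => (y s).2.2)) := by
      rw [hzB, hB']; funext t; exact hcancel _ _
    simp only [fbn]
    rw [this, Function.leftInverse_invFun hcb, hz, hfb, gC]
  have hu2 : (fun t => (y t).2.1.1) = u := funext hcon
  have hv1 : v1 (fun t => (y t).1)
      = c1 m.2.1 + fun t : Fin n => if (t : ℕ) < k then (ω t).2.2.1 else (ω t).1.2.1 := by
    funext t
    change (y t).1.1 + (fbn u t).1 = _
    rw [hfbn]
    simp only [Pi.add_apply]
    split_ifs with ht
    · simp only [hω, noiseOf, enc]
      generalize c1 m.2.1 t = a; generalize (y t).1.1 = b; generalize (y t).2.2.1 = d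
      revert a b d; decide
    · simp only [hω, noiseOf, enc]
      generalize c1 m.2.1 t = a; generalize (y t).1.1 = b
      revert a b; decide
  have hv2 : v2 (fun t => (y t).2.1)
      = c2 m.2.2 + fun t : Fin n => if (t : ℕ) < k then (ω t).2.2.2 else (ω t).1.2.2 := by
    funext t
    change (y t).2.1.2 + (fbn (fun t => (y t).2.1.1) t).2 = _
    rw [hu2, hfbn]
    simp only [Pi.add_apply]
    split_ifs with ht
    · simp only [hω, noiseOf, enc]
      generalize c2 m.2.2 t = a; generalize (y t).2.1.2 = b; generalize (y t).2.2.2.2 = d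
      revert a b d; decide
    · simp only [hω, noiseOf, enc]
      generalize c2 m.2.2 t = a; generalize (y t).2.1.2 = b
      revert a b; decide
  constructor
  · change (msg0 u, Function.invFun c1 (v1 (fun t => (y t).1) +
      D1 (zA u + zB u) (E1 (v1 fun t => (y t).1)))) = _
    rw [hm0, hz, hv1, map_add, hE1, zero_add, g1]
    have : ∀ a b : Fin n → Bool, a + b + b = a := fun a b => funext fun t => hcancel _ _
    rw [this, Function.leftInverse_invFun hc1]
  · change (msg0 (fun t => (y t).2.1.1), Function.invFun c2 (v2 (fun t => (y t).2.1) +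
      D2 (zA (fun t => (y t).2.1.1) + zB fun t => (y t).2.1.1) (E2 (v2 fun t => (y t).2.1)))) = _
    rw [hu2, hm0, hz, hv2, map_add, hE2, zero_add, g2]
    have : ∀ a b : Fin n → Bool, a + b + b = a := fun a b => funext fun t => hcancel _ _
    rw [this, Function.leftInverse_invFun hc2]

/-- The law of `Z₀`. -/
def marg0 (P : Bool × Bool × Bool → ℝ) (a : Bool) : ℝ := ∑ b, ∑ c, P (a, b, c)

/-- The joint law of `(Z₀, Z₁)`. -/
def marg01 (P : Bool × Bool × Bool → ℝ) (a b : Bool) : ℝ := ∑ c, P (a, b, c)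

/-- The joint law of `(Z₀, Z₂)`. -/
def marg02 (P : Bool × Bool × Bool → ℝ) (a c : Bool) : ℝ := ∑ b, P (a, b, c)

/-- The law with the same `(Z₀, Z₁)` and `(Z₀, Z₂)` marginals that makes `Z₁ — Z₀ — Z₂` Markov. -/
def markovized (P : Bool × Bool × Bool → ℝ) (z : Bool × Bool × Bool) : ℝ :=
  marg01 P z.1 z.2.1 * marg02 P z.1 z.2.2 / marg0 P z.1

/-- The entropy of `Z₀`. -/
def ent0 (P : Bool × Bool × Bool → ℝ) : ℝ := ∑ z, P z * -Real.logb 2 (marg0 P z.1)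

/-- The conditional entropy of `Z₁` given `Z₀`. -/
def ent1 (P : Bool × Bool × Bool → ℝ) : ℝ :=
  ∑ z, P z * -Real.logb 2 (marg01 P z.1 z.2.1 / marg0 P z.1)

/-- The conditional entropy of `Z₂` given `Z₀`. -/
def ent2 (P : Bool × Bool × Bool → ℝ) : ℝ :=
  ∑ z, P z * -Real.logb 2 (marg02 P z.1 z.2.2 / marg0 P z.1)

/-- The conditional entropy of `(Z₁, Z₂)` given `Z₀`. -/
def ent12 (P : Bool × Bool × Bool → ℝ) : ℝ := ∑ z, P z * -Real.logb 2 (P z / marg0 P z.1)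

section Entropy

theorem marg0_eq_sum_marg01 (P : Bool × Bool × Bool → ℝ) (a : Bool) :
    marg0 P a = ∑ b, marg01 P a b := rfl

theorem marg0_eq_sum_marg02 (P : Bool × Bool × Bool → ℝ) (a : Bool) :
    marg0 P a = ∑ c, marg02 P a c := Finset.sum_comm

theorem sum_marg0 (P : Bool × Bool × Bool → ℝ) : ∑ a, marg0 P a = ∑ z, P z := by
  simp only [Fintype.sum_prod_type, marg0]

variable {P : Bool × Bool × Bool → ℝ} (hP : ∀ z, 0 ≤ P z)
include hP

theorem marg01_nonneg (a b : Bool) : 0 ≤ marg01 P a b := Finset.sum_nonneg fun _ _ => hP _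

theorem marg02_nonneg (a c : Bool) : 0 ≤ marg02 P a c := Finset.sum_nonneg fun _ _ => hP _

theorem marg0_nonneg (a : Bool) : 0 ≤ marg0 P a := Finset.sum_nonneg fun b _ => marg01_nonneg hP a b

theorem le_marg01 (z : Bool × Bool × Bool) : P z ≤ marg01 P z.1 z.2.1 :=
  Finset.single_le_sum (f := fun c => P (z.1, z.2.1, c)) (fun _ _ => hP _) (Finset.mem_univ z.2.2)

theorem le_marg02 (z : Bool × Bool × Bool) : P z ≤ marg02 P z.1 z.2.2 :=
  Finset.single_le_sum (f := fun b => P (z.1, b, z.2.2)) (fun _ _ => hP _) (Finset.mem_univ z.2.1)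

theorem marg01_le_marg0 (a b : Bool) : marg01 P a b ≤ marg0 P a :=
  Finset.single_le_sum (f := fun b => marg01 P a b) (fun _ _ => marg01_nonneg hP _ _)
    (Finset.mem_univ b)

theorem marg02_le_marg0 (a c : Bool) : marg02 P a c ≤ marg0 P a := by
  rw [marg0_eq_sum_marg02]
  exact Finset.single_le_sum (f := fun c => marg02 P a c) (fun _ _ => marg02_nonneg hP _ _)
    (Finset.mem_univ c)

theorem le_marg0 (z : Bool × Bool × Bool) : P z ≤ marg0 P z.1 :=
  (le_marg01 hP z).trans (marg01_le_marg0 hP _ _)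

theorem markovized_nonneg (z : Bool × Bool × Bool) : 0 ≤ markovized P z :=
  div_nonneg (mul_nonneg (marg01_nonneg hP _ _) (marg02_nonneg hP _ _)) (marg0_nonneg hP _)

theorem marg01_markovized (a b : Bool) : marg01 (markovized P) a b = marg01 P a b := by
  by_cases h : marg0 P a = 0
  · have h1 := (marg01_le_marg0 hP a b).trans h.le
    rw [le_antisymm h1 (marg01_nonneg hP _ _)]
    simp only [marg01, markovized, h, div_zero, Finset.sum_const_zero]
  · rw [marg01]
    simp only [markovized]
    rw [← Finset.sum_div, ← Finset.mul_sum, ← marg0_eq_sum_marg02, mul_div_cancel_right₀ _ h]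

theorem marg02_markovized (a c : Bool) : marg02 (markovized P) a c = marg02 P a c := by
  by_cases h : marg0 P a = 0
  · have h1 := (marg02_le_marg0 hP a c).trans h.le
    rw [le_antisymm h1 (marg02_nonneg hP _ _)]
    simp only [marg02, markovized, h, div_zero, Finset.sum_const_zero]
  · rw [marg02]
    simp only [markovized]
    rw [← Finset.sum_div, ← Finset.sum_mul, ← marg0_eq_sum_marg01, mul_div_assoc, mul_comm,
      div_mul_cancel₀ _ h]

theorem isPMF_markovized (h1 : ∑ z, P z = 1) : IsPMF (markovized P) := by
  refine ⟨markovized_nonneg hP, ?_⟩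
  rw [← sum_marg0] at h1 ⊢
  rw [← h1]
  refine Finset.sum_congr rfl fun a _ => ?_
  simp only [marg0_eq_sum_marg01, marg01_markovized hP]

theorem markovized_pos {z : Bool × Bool × Bool} (hz : 0 < P z) : 0 < markovized P z :=
  div_pos (mul_pos (hz.trans_le (le_marg01 hP z)) (hz.trans_le (le_marg02 hP z)))
    (hz.trans_le (le_marg0 hP z))

omit hP in
theorem mul_neg_logb_nonneg {x y : ℝ} (hx : 0 ≤ x) (hy0 : 0 ≤ y) (hy : y ≤ 1) :
    0 ≤ x * -Real.logb 2 y :=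
  mul_nonneg hx (neg_nonneg.2 (Real.logb_nonpos (by norm_num) hy0 hy))

theorem ent0_nonneg (h1 : ∑ z, P z = 1) : 0 ≤ ent0 P := by
  refine Finset.sum_nonneg fun z _ => mul_neg_logb_nonneg (hP z) (marg0_nonneg hP _) ?_
  rw [← h1, ← sum_marg0]
  exact Finset.single_le_sum (fun a _ => marg0_nonneg hP a) (Finset.mem_univ _)

theorem ent1_nonneg : 0 ≤ ent1 P :=
  Finset.sum_nonneg fun z _ => mul_neg_logb_nonneg (hP z)
    (div_nonneg (marg01_nonneg hP _ _) (marg0_nonneg hP _))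
    (div_le_one_of_le₀ (marg01_le_marg0 hP _ _) (marg0_nonneg hP _))

theorem ent2_nonneg : 0 ≤ ent2 P :=
  Finset.sum_nonneg fun z _ => mul_neg_logb_nonneg (hP z)
    (div_nonneg (marg02_nonneg hP _ _) (marg0_nonneg hP _))
    (div_le_one_of_le₀ (marg02_le_marg0 hP _ _) (marg0_nonneg hP _))

theorem ent12_nonneg : 0 ≤ ent12 P :=
  Finset.sum_nonneg fun z _ => mul_neg_logb_nonneg (hP z)
    (div_nonneg (hP _) (marg0_nonneg hP _))
    (div_le_one_of_le₀ (le_marg0 hP _) (marg0_nonneg hP _))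

theorem ent_sum_eq : ent0 P + ent1 P + ent2 P = ∑ z, P z * -Real.logb 2 (markovized P z) := by
  rw [ent0, ent1, ent2, ← Finset.sum_add_distrib, ← Finset.sum_add_distrib]
  refine Finset.sum_congr rfl fun z _ => ?_
  rcases (hP z).eq_or_lt with h | h
  · simp [← h]
  · have h0 := h.trans_le (le_marg0 hP z)
    have h1 := h.trans_le (le_marg01 hP z)
    have h2 := h.trans_le (le_marg02 hP z)
    rw [markovized, Real.logb_div h1.ne' h0.ne', Real.logb_div h2.ne' h0.ne',
      Real.logb_div (mul_pos h1 h2).ne' h0.ne', Real.logb_mul h1.ne' h2.ne']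
    ring

theorem ent0_add_ent12 : ent0 P + ent12 P = ∑ z, P z * -Real.logb 2 (P z) := by
  rw [ent0, ent12, ← Finset.sum_add_distrib]
  refine Finset.sum_congr rfl fun z _ => ?_
  rcases (hP z).eq_or_lt with h | h
  · simp [← h]
  · have h0 := h.trans_le (le_marg0 hP z)
    rw [Real.logb_div h.ne' h0.ne']
    ring

theorem ent0_add_ent1 : ent0 P + ent1 P = entOf P (fun z => (z.1, z.2.1)) := by
  have : ∀ a b, distOf P (fun z => (z.1, z.2.1)) (a, b) = marg01 P a b := fun a b => by
    simp only [distOf, prOf, Fintype.sum_prod_type, Fintype.sum_bool, Prod.mk.injEq, marg01]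
    cases a <;> cases b <;> simp
  rw [ent0, ent1, ← Finset.sum_add_distrib, entOf, ← Finset.sum_neg_distrib]
  have h : ∀ z, P z * -Real.logb 2 (marg0 P z.1)
      + P z * -Real.logb 2 (marg01 P z.1 z.2.1 / marg0 P z.1)
      = P z * -Real.logb 2 (marg01 P z.1 z.2.1) := fun z => by
    rcases (hP z).eq_or_lt with h | h
    · simp [← h]
    · rw [Real.logb_div (h.trans_le (le_marg01 hP z)).ne' (h.trans_le (le_marg0 hP z)).ne']
      ring
  simp only [h, Fintype.sum_prod_type, this]
  refine Finset.sum_congr rfl fun a _ => Finset.sum_congr rfl fun b _ => ?_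
  rw [← Finset.sum_mul]
  change marg01 P a b * _ = _
  ring

theorem ent0_add_ent2 : ent0 P + ent2 P = entOf P (fun z => (z.1, z.2.2)) := by
  have : ∀ a c, distOf P (fun z => (z.1, z.2.2)) (a, c) = marg02 P a c := fun a c => by
    simp only [distOf, prOf, Fintype.sum_prod_type, Fintype.sum_bool, Prod.mk.injEq, marg02]
    cases a <;> cases c <;> simp
  rw [ent0, ent2, ← Finset.sum_add_distrib, entOf, ← Finset.sum_neg_distrib]
  have h : ∀ z, P z * -Real.logb 2 (marg0 P z.1)
      + P z * -Real.logb 2 (marg02 P z.1 z.2.2 / marg0 P z.1)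
      = P z * -Real.logb 2 (marg02 P z.1 z.2.2) := fun z => by
    rcases (hP z).eq_or_lt with h | h
    · simp [← h]
    · rw [Real.logb_div (h.trans_le (le_marg02 hP z)).ne' (h.trans_le (le_marg0 hP z)).ne']
      ring
  simp only [h, Fintype.sum_prod_type, this]
  refine Finset.sum_congr rfl fun a _ => ?_
  rw [Finset.sum_comm]
  refine Finset.sum_congr rfl fun b _ => ?_
  rw [← Finset.sum_mul]
  change marg02 P a b * _ = _
  ring

theorem exists_ne_markovized
    (hnm : ¬ MarkovChain P (fun z => z.2.1) (fun z => z.1) (fun z => z.2.2)) :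
    ∃ z, P z ≠ markovized P z := by
  by_contra! hall
  refine hnm fun b a c => ?_
  have e1 : distOf P (fun z => (z.2.1, z.1, z.2.2)) (b, a, c) = P (a, b, c) := by
    simp only [distOf, prOf, Fintype.sum_prod_type, Fintype.sum_bool, Prod.mk.injEq]
    cases a <;> cases b <;> cases c <;> simp
  have e2 : distOf P (fun z => z.1) a = marg0 P a := by
    simp only [distOf, prOf, Fintype.sum_prod_type, Fintype.sum_bool, marg0]
    cases a <;> simp
  have e3 : distOf P (fun z => (z.2.1, z.1)) (b, a) = marg01 P a b := by
    simp only [distOf, prOf, Fintype.sum_prod_type, Fintype.sum_bool, Prod.mk.injEq, marg01]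
    cases a <;> cases b <;> simp
  have e4 : distOf P (fun z => (z.2.2, z.1)) (c, a) = marg02 P a c := by
    simp only [distOf, prOf, Fintype.sum_prod_type, Fintype.sum_bool, Prod.mk.injEq, marg02]
    cases a <;> cases c <;> simp
  simp only [e1, e2, e3, e4]
  by_cases h : marg0 P a = 0
  · rw [le_antisymm ((marg01_le_marg0 hP a b).trans h.le) (marg01_nonneg hP _ _), h]
    simp
  · rw [hall, markovized, div_mul_cancel₀ _ h]

omit hP in
/-- The strict form of Gibbs' inequality. -/
theorem gibbs_strict {Λ : Type*} [Fintype Λ] {p κ : Λ → ℝ} (hp : IsPMF p)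
    (hκ1 : ∑ l, κ l ≤ 1) (hκ0 : ∀ l, 0 ≤ κ l) (hpos : ∀ l, 0 < p l → 0 < κ l)
    (hne : ∃ l, p l ≠ κ l) :
    ∑ l, p l * -Real.logb 2 (p l) < ∑ l, p l * -Real.logb 2 (κ l) := by
  have hlt : ∃ l, κ l < p l := by
    by_contra! hle
    obtain ⟨l, hl⟩ := hne
    have := Finset.sum_lt_sum (fun i _ => hle i) ⟨l, Finset.mem_univ l, lt_of_le_of_ne (hle l) hl⟩
    rw [hp.2] at this
    linarith
  obtain ⟨l0, hl0⟩ := hlt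
  have hlog2 := Real.log_pos (by norm_num : (1 : ℝ) < 2)
  have hstep : ∀ l, p l * (Real.log (κ l) - Real.log (p l)) ≤ κ l - p l := fun l => by
    rcases (hp.1 l).eq_or_lt with h | h
    · simp [← h, hκ0 l]
    · rw [← Real.log_div (hpos l h).ne' h.ne']
      have := mul_le_mul_of_nonneg_left (Real.log_le_sub_one_of_pos (div_pos (hpos l h) h)) h.le
      rwa [mul_sub, mul_div_cancel₀ _ h.ne', mul_one] at this
  have hstrict : p l0 * (Real.log (κ l0) - Real.log (p l0)) < κ l0 - p l0 := by
    have h : 0 < p l0 := (hκ0 l0).trans_lt hl0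
    rw [← Real.log_div (hpos l0 h).ne' h.ne']
    have := mul_lt_mul_of_pos_left (Real.log_lt_sub_one_of_pos (div_pos (hpos l0 h) h)
      ((div_lt_one h).2 hl0).ne) h
    rwa [mul_sub, mul_div_cancel₀ _ h.ne', mul_one] at this
  have hsum := Finset.sum_lt_sum (fun l _ => hstep l) ⟨l0, Finset.mem_univ l0, hstrict⟩
  rw [Finset.sum_sub_distrib, hp.2] at hsum
  have : ∑ l, p l * -Real.logb 2 (κ l) - ∑ l, p l * -Real.logb 2 (p l)
      = -(∑ l, p l * (Real.log (κ l) - Real.log (p l))) / Real.log 2 := by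
    rw [← Finset.sum_sub_distrib, ← Finset.sum_neg_distrib, Finset.sum_div]
    refine Finset.sum_congr rfl fun l _ => ?_
    simp only [Real.logb]
    field_simp
    ring
  have h2 : 0 < -(∑ l, p l * (Real.log (κ l) - Real.log (p l))) / Real.log 2 :=
    div_pos (by linarith) hlog2
  linarith

theorem ent12_lt (h1 : ∑ z, P z = 1)
    (hnm : ¬ MarkovChain P (fun z => z.2.1) (fun z => z.1) (fun z => z.2.2)) :
    ent12 P < ent1 P + ent2 P := by
  have := gibbs_strict ⟨hP, h1⟩ (isPMF_markovized hP h1).2.le (markovized_nonneg hP)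
    (fun z hz => markovized_pos hP hz) (exists_ne_markovized hP hnm)
  rw [← ent_sum_eq hP, ← ent0_add_ent12 hP] at this
  linarith

end Entropy

theorem msgCard_pos {R : ℝ} (hR : 0 ≤ R) (n : ℕ) : 0 < msgCard n R :=
  Nat.floor_pos.2 (Real.one_le_rpow (by norm_num) (by positivity))

theorem msgCard_mul_two_pow_le {N k : ℕ} {R c : ℝ} (hc : 0 ≤ c) (h : N * R + N * c + 1 ≤ k) :
    msgCard N R * 2 ^ ⌈N * c⌉₊ ≤ 2 ^ k := by
  have h1 : (msgCard N R : ℝ) ≤ (2 : ℝ) ^ ((N : ℝ) * R) := Nat.floor_le (by positivity)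
  have h2 : ((2 : ℝ) ^ ⌈(N : ℝ) * c⌉₊) ≤ (2 : ℝ) ^ ((N : ℝ) * c + 1) := by
    rw [← Real.rpow_natCast]
    exact Real.rpow_le_rpow_of_exponent_le (by norm_num) (Nat.ceil_lt_add_one (by positivity)).le
  have h3 : (2 : ℝ) ^ ((N : ℝ) * R) * (2 : ℝ) ^ ((N : ℝ) * c + 1) ≤ (2 : ℝ) ^ k := by
    rw [← Real.rpow_add (by norm_num), ← Real.rpow_natCast]
    exact Real.rpow_le_rpow_of_exponent_le (by norm_num) (by linarith)
  have := (mul_le_mul h1 h2 (by positivity) (by positivity)).trans h3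
  exact_mod_cast this

theorem two_pow_ceil_mul_le {N k : ℕ} {c d : ℝ} (hc : 0 ≤ c) (hd : 0 ≤ d)
    (h : N * d + N * c + 2 ≤ k) : 2 ^ ⌈N * d⌉₊ * 2 ^ ⌈N * c⌉₊ ≤ 2 ^ k := by
  rw [← pow_add]
  refine Nat.pow_le_pow_right (by norm_num) ?_
  have h1 := Nat.ceil_lt_add_one (a := (N : ℝ) * c) (by positivity)
  have h2 := Nat.ceil_lt_add_one (a := (N : ℝ) * d) (by positivity)
  have : ((⌈(N : ℝ) * d⌉₊ + ⌈(N : ℝ) * c⌉₊ : ℕ) : ℝ) ≤ k := by push_cast; linarith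
  exact_mod_cast this

/-- Codes with vanishing error probability at all large blocklengths suffice for achievability. -/
theorem achievableFB_of_eventually {X Y1 Y2 Yt : Type*} [Fintype X] [Fintype Y1] [Fintype Y2]
    [Fintype Yt] [Nonempty X] {W : X → Y1 × Y2 × Yt → ℝ} (hW : ∀ x y, 0 ≤ W x y) {R0 R1 R2 : ℝ}
    (h0 : 0 ≤ R0) (h1 : 0 ≤ R1) (h2 : 0 ≤ R2) {e : ℕ → ℝ} (he : Tendsto e atTop (𝓝 0))
    (h : ∀ᶠ n in atTop, ∃ enc dec1 dec2, Causal n enc ∧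
      errProbFB W n R0 R1 R2 enc dec1 dec2 ≤ e n) : AchievableFB W R0 R1 R2 := by
  have hdef : ∀ n, ∃ (enc : Fin n →
      Fin (msgCard n R0) × Fin (msgCard n R1) × Fin (msgCard n R2) → (Fin n → Yt) → X)
      (dec1 : (Fin n → Y1) → Fin (msgCard n R0) × Fin (msgCard n R1))
      (dec2 : (Fin n → Y2) → Fin (msgCard n R0) × Fin (msgCard n R2)), Causal n enc ∧
      ((∃ enc dec1 dec2, Causal n enc ∧ errProbFB W n R0 R1 R2 enc dec1 dec2 ≤ e n) →
        errProbFB W n R0 R1 R2 enc dec1 dec2 ≤ e n) := by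
    intro n
    by_cases hn : ∃ enc dec1 dec2, Causal n enc ∧ errProbFB W n R0 R1 R2 enc dec1 dec2 ≤ e n
    · obtain ⟨enc, dec1, dec2, hc, hle⟩ := hn
      exact ⟨enc, dec1, dec2, hc, fun _ => hle⟩
    · let m0 : Fin (msgCard n R0) := ⟨0, msgCard_pos h0 n⟩
      let m1 : Fin (msgCard n R1) := ⟨0, msgCard_pos h1 n⟩
      let m2 : Fin (msgCard n R2) := ⟨0, msgCard_pos h2 n⟩
      exact ⟨fun _ _ _ => Classical.arbitrary X, fun _ => (m0, m1), fun _ => (m0, m2),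
        fun _ _ _ _ _ => rfl, fun h => absurd h hn⟩
  choose enc dec1 dec2 hc hle using hdef
  refine ⟨h0, h1, h2, enc, dec1, dec2, hc, squeeze_zero' (Eventually.of_forall fun n => ?_)
    (h.mono fun n hn => hle n hn) he⟩
  refine mul_nonneg (by positivity) (Finset.sum_nonneg fun m _ => Finset.sum_nonneg fun y _ =>
    mul_nonneg (Finset.prod_nonneg fun t _ => hW _ _) ?_)
  split_ifs <;> norm_num

theorem exists_phase_hash_of_cost_le {Λ S V : Type*} [Fintype Λ] [AddCommGroup V] [Fintype V]
    (hsep : ∀ v : V, v ≠ 0 → ∃ φ : V →+ Bool, φ v = 1)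
    (p : Λ → ℝ) (hp : IsPMF p) (s : Λ → S) (uA uB : Λ → V) (κA κB : S → V → ℝ)
    (hA0 : ∀ σ v, 0 ≤ κA σ v) (hB0 : ∀ σ v, 0 ≤ κB σ v)
    (hA1 : ∀ σ, ∑ v, κA σ v ≤ 1) (hB1 : ∀ σ, ∑ v, κB σ v ≤ 1)
    (hA : ∀ l, 0 < p l → 0 < κA (s l) (uA l)) (hB : ∀ l, 0 < p l → 0 < κB (s l) (uB l))
    {a b α c : ℝ}
    (ha : ∑ l, p l * -Real.logb 2 (κA (s l) (uA l)) ≤ a)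
    (hb : ∑ l, p l * -Real.logb 2 (κB (s l) (uB l)) ≤ b)
    (hα0 : 0 ≤ α) (hα1 : α ≤ 1) (hc : α * a + (1 - α) * b < c) :
    ∃ e : ℕ → ℝ, Tendsto e atTop (𝓝 0) ∧ ∀ N : ℕ,
      ∃ (A : (Fin N → V) →+ (Fin ⌈N * c⌉₊ → Bool)) (D : (Fin N → S) → (Fin ⌈N * c⌉₊ → Bool) →
          (Fin N → V)),
        prOf (fun ω : Fin N → Λ => ∏ t, p (ω t)) (fun ω =>
          D (fun t => s (ω t)) (A fun t : Fin N => if (t : ℕ) < ⌊α * N⌋₊ then uA (ω t) else uB (ω t))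
            ≠ fun t : Fin N => if (t : ℕ) < ⌊α * N⌋₊ then uA (ω t) else uB (ω t)) ≤ e N :=
  exists_phase_hash hsep p hp s uA uB κA κB hA0 hB0 hA1 hB1 hA hB
    (cA := a + (c - (α * a + (1 - α) * b)) / 2) (cB := b + (c - (α * a + (1 - α) * b)) / 2)
    (by linarith) (by linarith) hα0 hα1 (by linarith)

/-- The law of a `Bern(η)` bit. -/
def bern (η : ℝ) (b : Bool) : ℝ := if b then η else 1 - η

/-- An upper bound for the cost of describing a bit of bias at most `η` using a `Bern(η)` code. -/
def bernCost (η : ℝ) : ℝ := -Real.logb 2 (1 - η) - η * Real.logb 2 η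

theorem bern_pos {η : ℝ} (h0 : 0 < η) (h1 : η < 1) (b : Bool) : 0 < bern η b := by
  cases b <;> simp [bern] <;> linarith

theorem sum_bern (η : ℝ) : ∑ b, bern η b = 1 := by simp [bern]

theorem sum_neg_logb_bern_le {Λ : Type*} [Fintype Λ] {Q : Λ → ℝ} (hQ : IsPMF Q) (X : Λ → Bool)
    {η : ℝ} (h0 : 0 < η) (h1 : η < 1) (h : distOf Q X true ≤ η) :
    ∑ w, Q w * -Real.logb 2 (bern η (X w)) ≤ bernCost η := by
  have hL1 : Real.logb 2 (1 - η) ≤ 0 := Real.logb_nonpos (by norm_num) (by linarith) (by linarith)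
  have hL : Real.logb 2 η ≤ 0 := Real.logb_nonpos (by norm_num) h0.le h1.le
  calc ∑ w, Q w * -Real.logb 2 (bern η (X w))
      ≤ ∑ w, (Q w * -Real.logb 2 (1 - η) + (if X w = true then Q w else 0) * -Real.logb 2 η) := by
        refine Finset.sum_le_sum fun w _ => ?_
        have := hQ.1 w
        cases hX : X w
        · simp [bern]
        · simp only [bern, if_true]
          nlinarith
    _ = -Real.logb 2 (1 - η) + distOf Q X true * -Real.logb 2 η := by
        rw [Finset.sum_add_distrib, ← Finset.sum_mul, ← Finset.sum_mul, hQ.2, one_mul]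
        simp only [distOf, prOf]
        congr!
    _ ≤ bernCost η := by unfold bernCost; nlinarith

theorem tendsto_bernCost : Tendsto bernCost (𝓝[>] 0) (𝓝 0) := by
  have h : ContinuousAt bernCost 0 := by
    unfold bernCost
    have e : (fun η : ℝ => -Real.logb 2 (1 - η) - η * Real.logb 2 η)
        = fun η : ℝ => -(Real.log (1 - η) / Real.log 2) - η * Real.log η / Real.log 2 := by
      funext η; simp only [Real.logb]; ring
    rw [e]
    refine ContinuousAt.sub (ContinuousAt.neg (ContinuousAt.div_const ?_ _))
      (Real.continuous_mul_log.continuousAt.div_const _)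
    exact ContinuousAt.log (by fun_prop) (by norm_num)
  have h2 : bernCost 0 = 0 := by simp [bernCost]
  have := h.tendsto
  rw [h2] at this
  exact this.mono_left nhdsWithin_le_nhds

/-- The kernel from `Z₀` to `(Z₁ ⊕ W₁, Z₂ ⊕ W₂)` with independent `Bern(η)` bits `W₁, W₂`. -/
def noisyKernel (P : Bool × Bool × Bool → ℝ) (η : ℝ) (a : Bool) (u : Bool × Bool) : ℝ :=
  (∑ w : Bool × Bool, bern η w.1 * bern η w.2 * P (a, u.1 + w.1, u.2 + w.2)) / marg0 P a

theorem sum_noisyKernel_le (P : Bool × Bool × Bool → ℝ) (η : ℝ) (a : Bool) :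
    ∑ u, noisyKernel P η a u ≤ 1 := by
  simp only [noisyKernel]
  rw [← Finset.sum_div]
  have : ∑ u : Bool × Bool, ∑ w : Bool × Bool,
      bern η w.1 * bern η w.2 * P (a, u.1 + w.1, u.2 + w.2) = marg0 P a := by
    rw [Finset.sum_comm]
    have e : ∀ w : Bool × Bool, ∑ u : Bool × Bool,
        bern η w.1 * bern η w.2 * P (a, u.1 + w.1, u.2 + w.2)
          = bern η w.1 * bern η w.2 * marg0 P a := fun w => by
      rw [← Finset.mul_sum, marg0, ← Fintype.sum_prod_type (f := fun u : Bool × Bool => P (a, u))]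
      congr 1
      exact Equiv.sum_comp (Equiv.addRight w) fun u : Bool × Bool => P (a, u)
    rw [Finset.sum_congr rfl fun w _ => e w, ← Finset.sum_mul, Fintype.sum_prod_type]
    simp only
    rw [← Fintype.sum_mul_sum, sum_bern, one_mul, one_mul]
  rw [this]
  exact div_self_le_one _

theorem noisyKernel_ge {P : Bool × Bool × Bool → ℝ} (hP : ∀ z, 0 ≤ P z) {η : ℝ} (h0 : 0 < η)
    (h1 : η < 1) (z : Bool × Bool × Bool) (w1 w2 : Bool) :
    bern η w1 * bern η w2 * (P z / marg0 P z.1)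
      ≤ noisyKernel P η z.1 (z.2.1 + w1, z.2.2 + w2) := by
  rw [noisyKernel, ← mul_div_assoc]
  refine div_le_div_of_nonneg_right ?_ (marg0_nonneg hP _)
  have hcancel : ∀ a b : Bool, a + b + b = a := by decide
  have := Finset.single_le_sum (f := fun w : Bool × Bool =>
      bern η w.1 * bern η w.2 * P (z.1, (z.2.1 + w1) + w.1, (z.2.2 + w2) + w.2))
    (fun w _ => mul_nonneg (mul_nonneg (bern_pos h0 h1 _).le (bern_pos h0 h1 _).le) (hP _))
    (Finset.mem_univ (w1, w2))
  simpa only [hcancel] using this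

theorem noisyKernel_nonneg {P : Bool × Bool × Bool → ℝ} (hP : ∀ z, 0 ≤ P z) {η : ℝ} (h0 : 0 < η)
    (h1 : η < 1) (a : Bool) (u : Bool × Bool) : 0 ≤ noisyKernel P η a u :=
  div_nonneg (Finset.sum_nonneg fun _ _ =>
    mul_nonneg (mul_nonneg (bern_pos h0 h1 _).le (bern_pos h0 h1 _).le) (hP _)) (marg0_nonneg hP _)

section ProductLaw

variable {P Q : Bool × Bool × Bool → ℝ}

theorem isPMF_mul {Λ Γ : Type*} [Fintype Λ] [Fintype Γ] {P : Λ → ℝ} {Q : Γ → ℝ} (hP : IsPMF P)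
    (hQ : IsPMF Q) : IsPMF fun l : Λ × Γ => P l.1 * Q l.2 := by
  refine ⟨fun l => mul_nonneg (hP.1 _) (hQ.1 _), ?_⟩
  rw [Fintype.sum_prod_type, ← Fintype.sum_mul_sum, hP.2, hQ.2, one_mul]

theorem sum_mul_fst {Λ Γ : Type*} [Fintype Λ] [Fintype Γ] (P : Λ → ℝ) {Q : Γ → ℝ}
    (hQ : IsPMF Q) (F : Λ → ℝ) : ∑ l : Λ × Γ, P l.1 * Q l.2 * F l.1 = ∑ z, P z * F z := by
  rw [Fintype.sum_prod_type]
  refine Finset.sum_congr rfl fun z _ => ?_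
  simp only
  rw [← Finset.sum_mul, ← Finset.mul_sum, hQ.2, mul_one]

theorem sum_mul_snd {Λ Γ : Type*} [Fintype Λ] [Fintype Γ] {P : Λ → ℝ} (Q : Γ → ℝ)
    (hP : IsPMF P) (F : Γ → ℝ) : ∑ l : Λ × Γ, P l.1 * Q l.2 * F l.2 = ∑ w, Q w * F w := by
  rw [Fintype.sum_prod_type, Finset.sum_comm]
  refine Finset.sum_congr rfl fun w _ => ?_
  simp only
  rw [← Finset.sum_mul, ← Finset.sum_mul, hP.2, one_mul]

theorem sum_noisyKernel_cost_le (hP : IsPMF P) (hQ : IsPMF Q) {η : ℝ} (h0 : 0 < η) (h1 : η < 1)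
    (hq1 : distOf Q (fun v => v.2.1) true ≤ η) (hq2 : distOf Q (fun v => v.2.2) true ≤ η) :
    ∑ l : (Bool × Bool × Bool) × (Bool × Bool × Bool), P l.1 * Q l.2 *
        -Real.logb 2 (noisyKernel P η l.1.1 (l.1.2.1 + l.2.2.1, l.1.2.2 + l.2.2.2))
      ≤ ent12 P + 2 * bernCost η := by
  have c1 := sum_neg_logb_bern_le hQ (fun v => v.2.1) h0 h1 hq1
  have c2 := sum_neg_logb_bern_le hQ (fun v => v.2.2) h0 h1 hq2
  rw [← sum_mul_snd (P := P) Q hP fun w => -Real.logb 2 (bern η w.2.1)] at c1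
  rw [← sum_mul_snd (P := P) Q hP fun w => -Real.logb 2 (bern η w.2.2)] at c2
  have c3 := sum_mul_fst P hQ fun z => -Real.logb 2 (P z / marg0 P z.1)
  have : ∑ l : (Bool × Bool × Bool) × (Bool × Bool × Bool), P l.1 * Q l.2 *
        -Real.logb 2 (noisyKernel P η l.1.1 (l.1.2.1 + l.2.2.1, l.1.2.2 + l.2.2.2))
      ≤ ∑ l : (Bool × Bool × Bool) × (Bool × Bool × Bool),
        (P l.1 * Q l.2 * -Real.logb 2 (P l.1 / marg0 P l.1.1)
          + P l.1 * Q l.2 * -Real.logb 2 (bern η l.2.2.1)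
          + P l.1 * Q l.2 * -Real.logb 2 (bern η l.2.2.2)) := by
    refine Finset.sum_le_sum fun l _ => ?_
    rw [← mul_add, ← mul_add]
    rcases (hP.1 l.1).eq_or_lt with h | h
    · simp [← h]
    · refine mul_le_mul_of_nonneg_left ?_ (mul_nonneg h.le (hQ.1 _))
      have hb1 := bern_pos h0 h1 l.2.2.1
      have hb2 := bern_pos h0 h1 l.2.2.2
      have hd := div_pos h (h.trans_le (le_marg0 hP.1 l.1))
      have hge := noisyKernel_ge hP.1 h0 h1 l.1 l.2.2.1 l.2.2.2
      have := Real.logb_le_logb_of_le (by norm_num : (1 : ℝ) < 2) (by positivity) hge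
      rw [Real.logb_mul (by positivity) hd.ne', Real.logb_mul hb1.ne' hb2.ne'] at this
      linarith
  rw [Finset.sum_add_distrib, Finset.sum_add_distrib, c3] at this
  change _ ≤ ent12 P + _ + _ at this
  linarith

end ProductLaw

theorem dueckNoisyW_nonneg {P Q : Bool × Bool × Bool → ℝ} (hP : ∀ z, 0 ≤ P z) (hQ : ∀ z, 0 ≤ Q z)
    (x : Bool × Bool × Bool) (y : (Bool × Bool) × (Bool × Bool) × (Bool × Bool × Bool)) :
    0 ≤ dueckNoisyW P Q x y := by
  rw [dueckNoisyW_eq]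
  split_ifs
  exacts [mul_nonneg (hP _) (hQ _), le_rfl]

/-- The kernel putting all its mass at zero. -/
def zeroKernel {V : Type*} [Zero V] (v : V) : ℝ := if v = 0 then 1 else 0

theorem zeroKernel_nonneg {V : Type*} [Zero V] (v : V) : 0 ≤ zeroKernel v := by
  unfold zeroKernel; split_ifs <;> norm_num

theorem zeroKernel_zero {V : Type*} [Zero V] : zeroKernel (0 : V) = 1 := if_pos rfl

theorem sum_zeroKernel {V : Type*} [Zero V] [Fintype V] : ∑ v : V, zeroKernel v = 1 := by
  simp [zeroKernel]

/-- The rates of the two-phase scheme with a fraction `α` of the time in the first phase. -/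
theorem achievableFB_of_phase {P Q : Bool × Bool × Bool → ℝ} (hP : IsPMF P) (hQ : IsPMF Q)
    {η : ℝ} (hη0 : 0 < η) (hη1 : η < 1)
    (hq1 : distOf Q (fun v => v.2.1) true ≤ η) (hq2 : distOf Q (fun v => v.2.2) true ≤ η)
    {α : ℝ} (hα0 : 0 ≤ α) (hα1 : α ≤ 1) {R0 R1 R2 ca cb cc c1 c2 : ℝ}
    (hR0 : 0 ≤ R0) (hR1 : 0 ≤ R1) (hR2 : 0 ≤ R2) (hca0 : 0 ≤ ca) (hcb0 : 0 ≤ cb) (hcc0 : 0 ≤ cc)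
    (hc10 : 0 ≤ c1) (hc20 : 0 ≤ c2)
    (hca : α * ent0 P < ca) (hcb : (1 - α) * ent0 P < cb)
    (hcc : α * (ent12 P + 2 * bernCost η) < cc)
    (hc1 : α * bernCost η + (1 - α) * ent1 P < c1) (hc2 : α * bernCost η + (1 - α) * ent2 P < c2)
    (hr0 : R0 + ca < α) (hrb : cc + cb < 1 - α) (hr1 : R1 + c1 < 1) (hr2 : R2 + c2 < 1) :
    AchievableFB (dueckNoisyW P Q) R0 R1 R2 := by
  have hp := isPMF_mul hP hQ
  have hpos : ∀ l : (Bool × Bool × Bool) × (Bool × Bool × Bool), 0 < P l.1 * Q l.2 → 0 < P l.1 :=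
    fun l hl => (hP.1 _).lt_of_ne fun h => by rw [← h, zero_mul] at hl; exact hl.false
  have hm0 : ∑ a, marg0 P a ≤ 1 := by rw [sum_marg0, hP.2]
  obtain ⟨eA, heA, hA⟩ := exists_phase_hash_of_cost_le separating_bool _ hp (fun _ => ())
    (fun l => l.1.1) (fun _ => 0) (fun _ => marg0 P) (fun _ => zeroKernel)
    (fun _ => marg0_nonneg hP.1) (fun _ => zeroKernel_nonneg) (fun _ => hm0)
    (fun _ => sum_zeroKernel.le) (fun l hl => (hpos l hl).trans_le (le_marg0 hP.1 _))
    (fun _ _ => by rw [zeroKernel_zero]; exact one_pos) (a := ent0 P) (b := 0)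
    (sum_mul_fst P hQ fun z => -Real.logb 2 (marg0 P z.1)).le (by simp [zeroKernel_zero])
    hα0 hα1 (c := ca) (by linarith)
  obtain ⟨eB, heB, hB⟩ := exists_phase_hash_of_cost_le separating_bool _ hp (fun _ => ())
    (fun _ => 0) (fun l => l.1.1) (fun _ => zeroKernel) (fun _ => marg0 P)
    (fun _ => zeroKernel_nonneg) (fun _ => marg0_nonneg hP.1) (fun _ => sum_zeroKernel.le)
    (fun _ => hm0) (fun _ _ => by rw [zeroKernel_zero]; exact one_pos)
    (fun l hl => (hpos l hl).trans_le (le_marg0 hP.1 _)) (a := 0) (b := ent0 P)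
    (by simp [zeroKernel_zero]) (sum_mul_fst P hQ fun z => -Real.logb 2 (marg0 P z.1)).le
    hα0 hα1 (c := cb) (by linarith)
  obtain ⟨eC, heC, hC⟩ := exists_phase_hash_of_cost_le separating_bool_prod _ hp (fun l => l.1.1)
    (fun l => (l.1.2.1 + l.2.2.1, l.1.2.2 + l.2.2.2)) (fun _ => 0) (noisyKernel P η)
    (fun _ => zeroKernel) (noisyKernel_nonneg hP.1 hη0 hη1) (fun _ => zeroKernel_nonneg)
    (sum_noisyKernel_le P η) (fun _ => sum_zeroKernel.le)
    (fun l hl => lt_of_lt_of_le (mul_pos (mul_pos (bern_pos hη0 hη1 _) (bern_pos hη0 hη1 _))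
      (div_pos (hpos l hl) ((hpos l hl).trans_le (le_marg0 hP.1 _))))
      (noisyKernel_ge hP.1 hη0 hη1 l.1 l.2.2.1 l.2.2.2))
    (fun _ _ => by rw [zeroKernel_zero]; exact one_pos) (b := 0)
    (sum_noisyKernel_cost_le hP hQ hη0 hη1 hq1 hq2) (by simp [zeroKernel_zero])
    hα0 hα1 (c := cc) (by linarith)
  have hk1 : ∀ a, ∑ b, marg01 P a b / marg0 P a ≤ 1 := fun a => by
    rw [← Finset.sum_div, ← marg0_eq_sum_marg01]; exact div_self_le_one _
  have hk2 : ∀ a, ∑ b, marg02 P a b / marg0 P a ≤ 1 := fun a => by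
    rw [← Finset.sum_div, ← marg0_eq_sum_marg02]; exact div_self_le_one _
  obtain ⟨e1, he1, hE1⟩ := exists_phase_hash_of_cost_le separating_bool _ hp (fun l => l.1.1)
    (fun l => l.2.2.1) (fun l => l.1.2.1) (fun _ => bern η) (fun a b => marg01 P a b / marg0 P a)
    (fun _ b => (bern_pos hη0 hη1 b).le)
    (fun a b => div_nonneg (marg01_nonneg hP.1 a b) (marg0_nonneg hP.1 a))
    (fun _ => (sum_bern η).le) hk1 (fun l _ => bern_pos hη0 hη1 _)
    (fun l hl => div_pos ((hpos l hl).trans_le (le_marg01 hP.1 _))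
      ((hpos l hl).trans_le (le_marg0 hP.1 _)))
    ((sum_mul_snd Q hP fun w => -Real.logb 2 (bern η w.2.1)).le.trans
      (sum_neg_logb_bern_le hQ (fun v => v.2.1) hη0 hη1 hq1))
    (sum_mul_fst P hQ fun z => -Real.logb 2 (marg01 P z.1 z.2.1 / marg0 P z.1)).le
    hα0 hα1 hc1
  obtain ⟨e2, he2, hE2⟩ := exists_phase_hash_of_cost_le separating_bool _ hp (fun l => l.1.1)
    (fun l => l.2.2.2) (fun l => l.1.2.2) (fun _ => bern η) (fun a b => marg02 P a b / marg0 P a)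
    (fun _ b => (bern_pos hη0 hη1 b).le)
    (fun a b => div_nonneg (marg02_nonneg hP.1 a b) (marg0_nonneg hP.1 a))
    (fun _ => (sum_bern η).le) hk2 (fun l _ => bern_pos hη0 hη1 _)
    (fun l hl => div_pos ((hpos l hl).trans_le (le_marg02 hP.1 _))
      ((hpos l hl).trans_le (le_marg0 hP.1 _)))
    ((sum_mul_snd Q hP fun w => -Real.logb 2 (bern η w.2.2)).le.trans
      (sum_neg_logb_bern_le hQ (fun v => v.2.2) hη0 hη1 hq2))
    (sum_mul_fst P hQ fun z => -Real.logb 2 (marg02 P z.1 z.2.2 / marg0 P z.1)).le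
    hα0 hα1 hc2
  have hlarge : ∀ a : ℝ, 0 < a → ∀ᶠ N : ℕ in atTop, 3 ≤ N * a := fun a ha =>
    (tendsto_natCast_atTop_atTop.atTop_mul_const ha).eventually_ge_atTop 3
  have he : Tendsto (fun N => eA N + (eB N + (eC N + (e1 N + e2 N)))) atTop (𝓝 0) := by
    simpa using heA.add (heB.add (heC.add (he1.add he2)))
  refine achievableFB_of_eventually (dueckNoisyW_nonneg hP.1 hQ.1) hR0 hR1 hR2 he ?_
  filter_upwards [hlarge (α - (R0 + ca)) (by linarith), hlarge (1 - α - (cc + cb)) (by linarith),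
    hlarge (1 - (R1 + c1)) (by linarith), hlarge (1 - (R2 + c2)) (by linarith)] with N l0 lb l1 l2
  obtain ⟨A, DA, hA⟩ := hA N
  obtain ⟨B, DB, hB⟩ := hB N
  obtain ⟨C, DC, hC⟩ := hC N
  obtain ⟨E1, D1, hE1⟩ := hE1 N
  obtain ⟨E2, D2, hE2⟩ := hE2 N
  have hkN : ⌊α * N⌋₊ ≤ N := floor_mul_le hα1 N
  have hk_lt := Nat.lt_floor_add_one (α * N)
  have hk_le := Nat.floor_le (a := α * N) (by positivity)
  have hcardA : (Finset.univ.filter fun t : Fin N => (t : ℕ) < ⌊α * N⌋₊).card = ⌊α * N⌋₊ := by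
    rw [Fin.card_filter_val_lt, min_eq_right hkN]
  have hcardB : (Finset.univ.filter fun t : Fin N => ¬ (t : ℕ) < ⌊α * N⌋₊).card
      = N - ⌊α * N⌋₊ := by
    have := Finset.card_filter_add_card_filter_not (s := Finset.univ)
      (fun t : Fin N => (t : ℕ) < ⌊α * N⌋₊)
    rw [hcardA, Finset.card_univ, Fintype.card_fin] at this
    omega
  have hcardN : (Finset.univ.filter fun _ : Fin N => True).card = N := by simp
  obtain ⟨k0, hk0, hk0A, hk0s⟩ := exists_injective_ker (M := Fin (msgCard N R0))
    (fun t : Fin N => (t : ℕ) < ⌊α * N⌋₊) A (by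
      rw [hcardA, Fintype.card_fin]
      exact msgCard_mul_two_pow_le hca0 (by linarith))
  obtain ⟨kb, hkb, hkbB, hkbs⟩ := exists_injective_ker (M := Fin ⌈N * cc⌉₊ → Bool)
    (fun t : Fin N => ¬ (t : ℕ) < ⌊α * N⌋₊) B (by
      rw [hcardB, Fintype.card_fun, Fintype.card_bool, Fintype.card_fin]
      refine two_pow_ceil_mul_le hcb0 hcc0 ?_
      rw [Nat.cast_sub hkN]
      linarith)
  obtain ⟨k1, hk1, hk1E, -⟩ := exists_injective_ker (M := Fin (msgCard N R1))
    (fun _ : Fin N => True) E1 (by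
      rw [hcardN, Fintype.card_fin]
      exact msgCard_mul_two_pow_le hc10 (by linarith))
  obtain ⟨k2, hk2, hk2E, -⟩ := exists_injective_ker (M := Fin (msgCard N R2))
    (fun _ : Fin N => True) E2 (by
      rw [hcardN, Fintype.card_fin]
      exact msgCard_mul_two_pow_le hc20 (by linarith))
  obtain ⟨enc, dec1, dec2, hcaus, hle⟩ := exists_feedback_code hP.1 hQ.1 N ⌊α * N⌋₊ R0 R1 R2
    A B C E1 E2 (DA fun _ => ()) (DB fun _ => ()) DC D1 D2 k0 kb k1 k2 hk0 hkb hk1 hk2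
    hk0A hkbB hk1E hk2E hk0s hkbs (msgCard_pos hR0 N) (msgCard_pos hR1 N) (msgCard_pos hR2 N)
  have hw : ∀ ω : Fin N → (Bool × Bool × Bool) × (Bool × Bool × Bool),
      0 ≤ ∏ t, P (ω t).1 * Q (ω t).2 :=
    fun ω => Finset.prod_nonneg fun t _ => hp.1 _
  refine ⟨enc, dec1, dec2, hcaus, hle.trans ?_⟩
  refine (prOf_or_le hw _ _).trans (add_le_add hA ?_)
  refine (prOf_or_le hw _ _).trans (add_le_add hB ?_)
  refine (prOf_or_le hw _ _).trans (add_le_add hC ?_)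
  exact (prOf_or_le hw _ _).trans (add_le_add hE1 hE2)

theorem sum_dueckNoisyW_fiber (P : Bool × Bool × Bool → ℝ) {Q : Bool × Bool × Bool → ℝ}
    (hQ : ∑ w, Q w = 1) (x : Bool × Bool × Bool) (γ : (Bool × Bool) × Bool × Bool) :
    ∑ l, (if (l.1, l.2.1) = γ then dueckNoisyW P Q x l else 0) = dueckW P x γ := by
  obtain ⟨⟨a1, a0⟩, b0, b2⟩ := γ
  have h : ∀ (a b : Bool × Bool), ∑ c : Bool × Bool × Bool, dueckNoisyW P Q x (a, b, c)
      = dueckW P x (a, b) := by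
    intro a b
    simp only [dueckNoisyW]
    rw [← Finset.mul_sum]
    convert mul_one _
    rw [← hQ]
    simp only [Fintype.sum_prod_type, Fintype.sum_bool]
    rcases a with ⟨_ | _, _ | _⟩ <;> rcases b with ⟨_, _ | _⟩ <;> simp <;> ring
  rw [← h, Fintype.sum_prod_type, Finset.sum_eq_single (a1, a0)]
  · rw [Fintype.sum_prod_type, Finset.sum_eq_single (b0, b2)]
    · simp
    · intro b _ hb
      simp [hb]
    · simp
  · intro a _ ha
    simp [ha]
  · simp

theorem errProbFB_const {P Q : Bool × Bool × Bool → ℝ} (hQ : ∑ w, Q w = 1) (n : ℕ) (R0 R1 R2 : ℝ)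
    (enc : Fin (msgCard n R0) × Fin (msgCard n R1) × Fin (msgCard n R2) → Fin n →
      Bool × Bool × Bool)
    (dec1 : (Fin n → Bool × Bool) → Fin (msgCard n R0) × Fin (msgCard n R1))
    (dec2 : (Fin n → Bool × Bool) → Fin (msgCard n R0) × Fin (msgCard n R2)) :
    errProbFB (dueckNoisyW P Q) n R0 R1 R2 (fun t m _ => enc m t) dec1 dec2
      = errProbNoFB (dueckW P) n R0 R1 R2 enc dec1 dec2 := by
  unfold errProbFB errProbNoFB
  congr 1
  refine Finset.sum_congr rfl fun m _ => ?_
  have := sum_prod_map (fun t => dueckNoisyW P Q (enc m t)) (fun l => (l.1, l.2.1))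
    (fun γ => if dec1 (fun t => (γ t).1) ≠ (m.1, m.2.1) ∨ dec2 (fun t => (γ t).2) ≠ (m.1, m.2.2)
      then (1 : ℝ) else 0)
  rw [this]
  refine Finset.sum_congr rfl fun γ _ => ?_
  congr 1
  refine Finset.prod_congr rfl fun t _ => ?_
  rw [← sum_dueckNoisyW_fiber P hQ]
  congr!

theorem cNoFB_subset {P Q : Bool × Bool × Bool → ℝ} (hQ : ∑ w, Q w = 1) :
    CNoFB (dueckW P) ⊆ CGenFB (dueckNoisyW P Q) := by
  refine closure_mono ?_
  rintro r ⟨h0, h1, h2, enc, dec1, dec2, h⟩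
  refine ⟨h0, h1, h2, fun n t m _ => enc n m t, dec1, dec2, fun n t m _ _ _ => rfl, ?_⟩
  simpa only [errProbFB_const hQ] using h

section Converse

theorem sum_dueckW_comp (P : Bool × Bool × Bool → ℝ) (x : Bool × Bool × Bool) {F : ℝ → ℝ}
    (hF : F 0 = 0) : ∑ y, F (dueckW P x y) = ∑ z, F (P z) := by
  simp only [dueckW, Fintype.sum_prod_type, Fintype.sum_bool]
  rcases x with ⟨_ | _, _ | _, _ | _⟩ <;> simp [hF] <;> ring

theorem isPMF_dueckW {P : Bool × Bool × Bool → ℝ} (hP : IsPMF P) (x : Bool × Bool × Bool) :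
    IsPMF (dueckW P x) := by
  refine ⟨fun y => ?_, (sum_dueckW_comp P x (F := id) rfl).trans hP.2⟩
  unfold dueckW
  split_ifs
  exacts [hP.1 _, le_rfl]

theorem sum_dueckW_fst (P : Bool × Bool × Bool → ℝ) (x : Bool × Bool × Bool) (γ : Bool × Bool) :
    ∑ y : (Bool × Bool) × Bool × Bool, (if y.1 = γ then dueckW P x y else 0)
      = marg01 P (Bool.xor x.2.1 γ.2) (Bool.xor x.1 γ.1) := by
  simp only [dueckW, Fintype.sum_prod_type, Fintype.sum_bool, marg01]
  rcases x with ⟨_ , _, _ | _⟩ <;> rcases γ with ⟨_ | _, _ | _⟩ <;> simp <;> ring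

theorem sum_dueckW_snd (P : Bool × Bool × Bool → ℝ) (x : Bool × Bool × Bool) (γ : Bool × Bool) :
    ∑ y : (Bool × Bool) × Bool × Bool, (if y.2 = γ then dueckW P x y else 0)
      = marg02 P (Bool.xor x.2.1 γ.1) (Bool.xor x.2.2 γ.2) := by
  simp only [dueckW, Fintype.sum_prod_type, Fintype.sum_bool, marg02]
  rcases x with ⟨_ | _, _, _⟩ <;> rcases γ with ⟨_ | _, _ | _⟩ <;> simp <;> ring

/-- The error probability is, up to a factor two, a function of the marginal channels only. -/
theorem errProbNoFB_markovized_le {P : Bool × Bool × Bool → ℝ} (hP : IsPMF P) (n : ℕ)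
    (R0 R1 R2 : ℝ)
    (enc : Fin (msgCard n R0) × Fin (msgCard n R1) × Fin (msgCard n R2) → Fin n →
      Bool × Bool × Bool)
    (dec1 : (Fin n → Bool × Bool) → Fin (msgCard n R0) × Fin (msgCard n R1))
    (dec2 : (Fin n → Bool × Bool) → Fin (msgCard n R0) × Fin (msgCard n R2)) :
    errProbNoFB (dueckW (markovized P)) n R0 R1 R2 enc dec1 dec2
      ≤ 2 * errProbNoFB (dueckW P) n R0 R1 R2 enc dec1 dec2 := by
  unfold errProbNoFB
  rw [mul_left_comm]
  refine mul_le_mul_of_nonneg_left ?_ (by positivity)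
  rw [Finset.mul_sum]
  refine Finset.sum_le_sum fun m _ => ?_
  have hprod0 : ∀ (P' : Bool × Bool × Bool → ℝ), IsPMF P' →
      ∀ y : Fin n → (Bool × Bool) × Bool × Bool, 0 ≤ ∏ t, dueckW P' (enc m t) (y t) :=
    fun P' hP' y => Finset.prod_nonneg fun t _ => (isPMF_dueckW hP' _).1 _
  have hM := isPMF_markovized hP.1 hP.2
  have e1 : ∀ P' : Bool × Bool × Bool → ℝ, ∑ y : Fin n → (Bool × Bool) × Bool × Bool,
      (∏ t, dueckW P' (enc m t) (y t)) *
        (if dec1 (fun t => (y t).1) ≠ (m.1, m.2.1) then (1 : ℝ) else 0)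
      = ∑ γ : Fin n → Bool × Bool, (∏ t, marg01 P' (Bool.xor (enc m t).2.1 (γ t).2)
          (Bool.xor (enc m t).1 (γ t).1)) * (if dec1 γ ≠ (m.1, m.2.1) then (1 : ℝ) else 0) := by
    intro P'
    rw [sum_prod_map (fun t => dueckW P' (enc m t)) Prod.fst
      (fun γ => if dec1 γ ≠ (m.1, m.2.1) then (1 : ℝ) else 0)]
    refine Finset.sum_congr rfl fun γ _ => ?_
    congr 1
    refine Finset.prod_congr rfl fun t _ => ?_
    rw [← sum_dueckW_fst]
    congr!
  have e2 : ∀ P' : Bool × Bool × Bool → ℝ, ∑ y : Fin n → (Bool × Bool) × Bool × Bool,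
      (∏ t, dueckW P' (enc m t) (y t)) *
        (if dec2 (fun t => (y t).2) ≠ (m.1, m.2.2) then (1 : ℝ) else 0)
      = ∑ γ : Fin n → Bool × Bool, (∏ t, marg02 P' (Bool.xor (enc m t).2.1 (γ t).1)
          (Bool.xor (enc m t).2.2 (γ t).2)) * (if dec2 γ ≠ (m.1, m.2.2) then (1 : ℝ) else 0) := by
    intro P'
    rw [sum_prod_map (fun t => dueckW P' (enc m t)) Prod.snd
      (fun γ => if dec2 γ ≠ (m.1, m.2.2) then (1 : ℝ) else 0)]
    refine Finset.sum_congr rfl fun γ _ => ?_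
    congr 1
    refine Finset.prod_congr rfl fun t _ => ?_
    rw [← sum_dueckW_snd]
    congr!
  have e1' := (e1 (markovized P)).trans (by simp only [marg01_markovized hP.1]; exact (e1 P).symm)
  have e2' := (e2 (markovized P)).trans (by simp only [marg02_markovized hP.1]; exact (e2 P).symm)
  calc _ ≤ ∑ y : Fin n → (Bool × Bool) × Bool × Bool,
        ((∏ t, dueckW (markovized P) (enc m t) (y t)) *
          (if dec1 (fun t => (y t).1) ≠ (m.1, m.2.1) then (1 : ℝ) else 0)
        + (∏ t, dueckW (markovized P) (enc m t) (y t)) *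
          (if dec2 (fun t => (y t).2) ≠ (m.1, m.2.2) then (1 : ℝ) else 0)) := by
        refine Finset.sum_le_sum fun y _ => ?_
        rw [← mul_add]
        refine mul_le_mul_of_nonneg_left ?_ (hprod0 _ hM y)
        by_cases h1 : dec1 (fun t => (y t).1) = (m.1, m.2.1) <;>
          by_cases h2 : dec2 (fun t => (y t).2) = (m.1, m.2.2) <;> simp [h1, h2]
    _ = _ := by rw [Finset.sum_add_distrib, e1', e2', ← Finset.sum_add_distrib]
    _ ≤ _ := by
        rw [Finset.mul_sum]
        refine Finset.sum_le_sum fun y _ => ?_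
        rw [← mul_add, mul_left_comm]
        refine mul_le_mul_of_nonneg_left ?_ (hprod0 _ hP y)
        by_cases h1 : dec1 (fun t => (y t).1) = (m.1, m.2.1) <;>
          by_cases h2 : dec2 (fun t => (y t).2) = (m.1, m.2.2) <;> simp [h1, h2, one_add_one_eq_two]

end Converse

section StrongConverse

/-- The indicator of the output pairs that agree on the common component. -/
def commonInd (y : (Bool × Bool) × Bool × Bool) : ℝ := if y.2.1 = y.1.2 then 1 else 0

theorem commonInd_nonneg (y : (Bool × Bool) × Bool × Bool) : 0 ≤ commonInd y := by
  unfold commonInd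
  split_ifs <;> norm_num

theorem dueckW_mul_commonInd (p : Bool × Bool × Bool → ℝ) (x : Bool × Bool × Bool)
    (y : (Bool × Bool) × Bool × Bool) : dueckW p x y * commonInd y = dueckW p x y := by
  unfold dueckW commonInd
  split_ifs <;> simp

theorem sum_prod_commonInd (n : ℕ) :
    ∑ y : Fin n → (Bool × Bool) × Bool × Bool, ∏ t, commonInd (y t) = 8 ^ n := by
  rw [sum_prod_pi (fun _ => commonInd)]
  have : ∑ l, commonInd l = 8 := by
    simp only [commonInd, Fintype.sum_prod_type, Fintype.sum_bool]
    norm_num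
  simp [this]

theorem sum_dueck_success_le {p : Bool × Bool × Bool → ℝ} (hp : IsPMF p) {c d s : ℝ} (hs : 0 < s)
    (hmgf : ∑ z, p z * (2 : ℝ) ^ (s * Real.logb 2 (p z)) ≤ (2 : ℝ) ^ (s * -d)) {n : ℕ}
    (x : Fin n → Bool × Bool × Bool)
    {g : (Fin n → (Bool × Bool) × Bool × Bool) → ℝ} (hg0 : ∀ y, 0 ≤ g y) (hg1 : ∀ y, g y ≤ 1) :
    ∑ y : Fin n → (Bool × Bool) × Bool × Bool, (∏ t, dueckW p (x t) (y t)) * g y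
      ≤ (2 : ℝ) ^ ((n : ℝ) * (s * (c - d)))
        + (2 : ℝ) ^ (-((n : ℝ) * c)) * ∑ y, (∏ t, commonInd (y t)) * g y := by
  have hW0 : ∀ t l, 0 ≤ dueckW p (x t) l := fun t => (isPMF_dueckW hp (x t)).1
  have hch := prOf_sum_ge_le (fun t => dueckW p (x t)) hW0
    (fun t l => Real.logb 2 (dueckW p (x t) l)) hs (-((n : ℝ) * c))
  have hF : ∀ t, ∑ l, dueckW p (x t) l * (2 : ℝ) ^ (s * Real.logb 2 (dueckW p (x t) l))
      = ∑ z, p z * (2 : ℝ) ^ (s * Real.logb 2 (p z)) := fun t =>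
    sum_dueckW_comp p (x t) (F := fun w => w * (2 : ℝ) ^ (s * Real.logb 2 w)) (by simp)
  have hch' : prOf (fun y : Fin n → (Bool × Bool) × Bool × Bool => ∏ t, dueckW p (x t) (y t))
      (fun y => -((n : ℝ) * c) ≤ ∑ t, Real.logb 2 (dueckW p (x t) (y t)))
      ≤ (2 : ℝ) ^ ((n : ℝ) * (s * (c - d))) := by
    refine hch.trans ?_
    calc _ ≤ (2 : ℝ) ^ (-(s * -((n : ℝ) * c))) * ((2 : ℝ) ^ (s * -d)) ^ n := by
          refine mul_le_mul_of_nonneg_left ?_ (by positivity)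
          simp only [hF, Finset.prod_const, Finset.card_univ, Fintype.card_fin]
          exact pow_le_pow_left₀ (Finset.sum_nonneg fun z _ =>
            mul_nonneg (hp.1 z) (by positivity)) hmgf n
      _ = _ := by
          rw [← Real.rpow_mul_natCast (by norm_num), ← Real.rpow_add (by norm_num)]
          congr 1
          ring
  refine le_trans ?_ (add_le_add_left hch' _)
  rw [prOf, Finset.mul_sum, ← Finset.sum_add_distrib]
  refine Finset.sum_le_sum fun y _ => ?_
  have hprod0 : 0 ≤ ∏ t, dueckW p (x t) (y t) := Finset.prod_nonneg fun t _ => hW0 _ _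
  have hc0 : 0 ≤ ∏ t, commonInd (y t) := Finset.prod_nonneg fun t _ => commonInd_nonneg _
  have hr : 0 ≤ (2 : ℝ) ^ (-((n : ℝ) * c)) * ((∏ t, commonInd (y t)) * g y) :=
    mul_nonneg (by positivity) (mul_nonneg hc0 (hg0 y))
  split_ifs with h
  · have := mul_le_of_le_one_right hprod0 (hg1 y)
    linarith
  · rw [zero_add]
    push Not at h
    have heq : ∏ t, dueckW p (x t) (y t)
        = (∏ t, dueckW p (x t) (y t)) * ∏ t, commonInd (y t) := by
      rw [← Finset.prod_mul_distrib]
      exact Finset.prod_congr rfl fun t _ => (dueckW_mul_commonInd p _ _).symm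
    rw [heq, mul_assoc]
    refine mul_le_mul_of_nonneg_right ?_ (mul_nonneg hc0 (hg0 y))
    by_cases hz : ∃ t, dueckW p (x t) (y t) = 0
    · obtain ⟨t, ht⟩ := hz
      rw [Finset.prod_eq_zero (Finset.mem_univ t) ht]
      positivity
    · push Not at hz
      have hpos : ∀ t, 0 < dueckW p (x t) (y t) := fun t => (hW0 _ _).lt_of_ne (hz t).symm
      calc ∏ t, dueckW p (x t) (y t)
          = ∏ t, (2 : ℝ) ^ Real.logb 2 (dueckW p (x t) (y t)) :=
            Finset.prod_congr rfl fun t _ =>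
              (Real.rpow_logb (by norm_num) (by norm_num) (hpos t)).symm
        _ = (2 : ℝ) ^ ∑ t, Real.logb 2 (dueckW p (x t) (y t)) :=
            (Real.rpow_sum_of_pos (by norm_num) _ _).symm
        _ ≤ _ := Real.rpow_le_rpow_of_exponent_le (by norm_num) h.le

/-- A strong converse: codes for the Dueck channel with noise law `p` whose sum rate is too large
are rarely decoded correctly. -/
theorem one_sub_errProbNoFB_le {p : Bool × Bool × Bool → ℝ} (hp : IsPMF p) {c d s : ℝ} (hs : 0 < s)
    (hmgf : ∑ z, p z * (2 : ℝ) ^ (s * Real.logb 2 (p z)) ≤ (2 : ℝ) ^ (s * -d)) {n : ℕ}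
    {R0 R1 R2 : ℝ} (hR0 : 0 ≤ R0) (hR1 : 0 ≤ R1) (hR2 : 0 ≤ R2)
    (enc : Fin (msgCard n R0) × Fin (msgCard n R1) × Fin (msgCard n R2) → Fin n →
      Bool × Bool × Bool)
    (dec1 : (Fin n → Bool × Bool) → Fin (msgCard n R0) × Fin (msgCard n R1))
    (dec2 : (Fin n → Bool × Bool) → Fin (msgCard n R0) × Fin (msgCard n R2)) :
    1 - errProbNoFB (dueckW p) n R0 R1 R2 enc dec1 dec2
      ≤ (2 : ℝ) ^ ((n : ℝ) * (s * (c - d)))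
        + 1 / ((msgCard n R0 : ℝ) * (msgCard n R1 : ℝ) * (msgCard n R2 : ℝ)) *
          ((2 : ℝ) ^ (-((n : ℝ) * c)) * 8 ^ n) := by
  set M : ℝ := (msgCard n R0 : ℝ) * (msgCard n R1 : ℝ) * (msgCard n R2 : ℝ) with hM
  have hMpos : 0 < M := by
    have h0 := msgCard_pos hR0 n
    have h1 := msgCard_pos hR1 n
    have h2 := msgCard_pos hR2 n
    positivity
  set e := (2 : ℝ) ^ ((n : ℝ) * (s * (c - d))) with he
  let G : Fin (msgCard n R0) × Fin (msgCard n R1) × Fin (msgCard n R2) →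
      (Fin n → (Bool × Bool) × Bool × Bool) → ℝ := fun m y =>
    if dec1 (fun t => (y t).1) ≠ (m.1, m.2.1) ∨ dec2 (fun t => (y t).2) ≠ (m.1, m.2.2)
      then 0 else 1
  have hG0 : ∀ m y, 0 ≤ G m y := fun m y => by simp only [G]; split_ifs <;> norm_num
  have hG1 : ∀ m y, G m y ≤ 1 := fun m y => by simp only [G]; split_ifs <;> norm_num
  have hmsg : ∀ m, 1 - (e + (2 : ℝ) ^ (-((n : ℝ) * c)) * ∑ y, (∏ t, commonInd (y t)) * G m y)
      ≤ ∑ y : Fin n → (Bool × Bool) × Bool × Bool, (∏ t, dueckW p (enc m t) (y t)) *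
        (if dec1 (fun t => (y t).1) ≠ (m.1, m.2.1) ∨ dec2 (fun t => (y t).2) ≠ (m.1, m.2.2)
          then 1 else 0) := by
    intro m
    have h := sum_dueck_success_le (c := c) hp hs hmgf (enc m) (hG0 m) (hG1 m)
    have h1 := (isPMF_prod fun t => isPMF_dueckW hp (enc m t)).2
    have h2 : ∑ y : Fin n → (Bool × Bool) × Bool × Bool, (∏ t, dueckW p (enc m t) (y t)) *
        (if dec1 (fun t => (y t).1) ≠ (m.1, m.2.1) ∨ dec2 (fun t => (y t).2) ≠ (m.1, m.2.2)
          then (1 : ℝ) else 0) + ∑ y, (∏ t, dueckW p (enc m t) (y t)) * G m y = 1 := by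
      rw [← Finset.sum_add_distrib]
      refine Eq.trans (Finset.sum_congr rfl fun y _ => ?_) h1
      simp only [G]
      split_ifs <;> ring
    linarith
  have hdisj : ∑ m, ∑ y : Fin n → (Bool × Bool) × Bool × Bool, (∏ t, commonInd (y t)) * G m y
      ≤ 8 ^ n := by
    rw [Finset.sum_comm, ← sum_prod_commonInd]
    refine Finset.sum_le_sum fun y _ => ?_
    rw [← Finset.mul_sum]
    refine mul_le_of_le_one_right (Finset.prod_nonneg fun t _ => commonInd_nonneg _) ?_
    let m0 : Fin (msgCard n R0) × Fin (msgCard n R1) × Fin (msgCard n R2) :=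
      ((dec1 fun t => (y t).1).1, (dec1 fun t => (y t).1).2, (dec2 fun t => (y t).2).2)
    rw [Finset.sum_eq_single m0]
    · exact hG1 _ _
    · intro m _ hm
      simp only [G]
      rw [if_pos]
      by_contra! hcon
      refine hm ?_
      simp only [m0, hcon.1, hcon.2]
    · simp
  have hsum := Finset.sum_le_sum fun m (_ : m ∈ Finset.univ) => hmsg m
  have hcard : (Fintype.card (Fin (msgCard n R0) × Fin (msgCard n R1) × Fin (msgCard n R2)) : ℝ)
      = M := by
    simp [hM, mul_assoc]
  rw [Finset.sum_sub_distrib, Finset.sum_add_distrib, ← Finset.mul_sum] at hsum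
  simp only [Finset.sum_const, Finset.card_univ, nsmul_eq_mul, hcard, mul_one] at hsum
  have hc2 := mul_le_mul_of_nonneg_left hdisj (by positivity : 0 ≤ (2 : ℝ) ^ (-((n : ℝ) * c)))
  have hfin : M - (M * e + (2 : ℝ) ^ (-((n : ℝ) * c)) * 8 ^ n)
      ≤ ∑ m, ∑ y : Fin n → (Bool × Bool) × Bool × Bool, (∏ t, dueckW p (enc m t) (y t)) *
        (if dec1 (fun t => (y t).1) ≠ (m.1, m.2.1) ∨ dec2 (fun t => (y t).2) ≠ (m.1, m.2.2)
          then 1 else 0) := by linarith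
  have hdiv := mul_le_mul_of_nonneg_left hfin (by positivity : 0 ≤ 1 / M)
  have hexp : 1 / M * (M - (M * e + (2 : ℝ) ^ (-((n : ℝ) * c)) * 8 ^ n))
      = 1 - e - 1 / M * ((2 : ℝ) ^ (-((n : ℝ) * c)) * 8 ^ n) := by
    field_simp
    ring
  rw [hexp] at hdiv
  unfold errProbNoFB
  linarith

end StrongConverse

section SumRate

theorem ent_sum_eq_entropy_markovized {P : Bool × Bool × Bool → ℝ} (hP : ∀ z, 0 ≤ P z) :
    ∑ z, markovized P z * Real.logb 2 (markovized P z) = -(ent0 P + ent1 P + ent2 P) := by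
  have m1 : ∀ a b, marg01 (markovized P) a b = marg01 P a b := marg01_markovized hP
  have m2 : ∀ a c, marg02 (markovized P) a c = marg02 P a c := marg02_markovized hP
  have m0 : ∀ a, marg0 (markovized P) a = marg0 P a := fun a => by
    simp only [marg0_eq_sum_marg01, m1]
  have hmm : ∀ z, markovized (markovized P) z = markovized P z := fun z => by
    simp only [markovized]
    rw [m0, m1, m2]
  have e0 : ∀ P', ent0 P' = ∑ a, marg0 P' a * -Real.logb 2 (marg0 P' a) := fun P' => by
    simp only [ent0, Fintype.sum_prod_type, ← Finset.sum_mul]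
    rfl
  have e1 : ∀ P', ent1 P' = ∑ a, ∑ b, marg01 P' a b
      * -Real.logb 2 (marg01 P' a b / marg0 P' a) := fun P' => by
    simp only [ent1, Fintype.sum_prod_type, ← Finset.sum_mul]
    rfl
  have e2 : ∀ P', ent2 P' = ∑ a, ∑ c, marg02 P' a c
      * -Real.logb 2 (marg02 P' a c / marg0 P' a) := fun P' => by
    simp only [ent2, Fintype.sum_prod_type]
    refine Finset.sum_congr rfl fun a _ => ?_
    rw [Finset.sum_comm]
    simp only [← Finset.sum_mul]
    rfl
  have h := ent_sum_eq (markovized_nonneg hP)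
  simp only [hmm, mul_neg, Finset.sum_neg_distrib] at h
  rw [e0 (markovized P), e1 (markovized P), e2 (markovized P)] at h
  simp only [m0, m1, m2] at h
  rw [← e0, ← e1, ← e2] at h
  linarith

theorem half_two_rpow_le_msgCard {R : ℝ} (hR : 0 ≤ R) (n : ℕ) :
    (2 : ℝ) ^ ((n : ℝ) * R - 1) ≤ msgCard n R := by
  have h1 : (1 : ℝ) ≤ msgCard n R := by exact_mod_cast msgCard_pos hR n
  have h2 : (2 : ℝ) ^ ((n : ℝ) * R) < msgCard n R + 1 := Nat.lt_floor_add_one _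
  rw [Real.rpow_sub_one (by norm_num)]
  linarith

/-- The outer bound on the sum rate of the Dueck channel without feedback. -/
theorem sumRate_le {P : Bool × Bool × Bool → ℝ} (hP : IsPMF P) {R0 R1 R2 : ℝ}
    (h : AchievableNoFB (dueckW P) R0 R1 R2) : R0 + R1 + R2 ≤ 3 - (ent0 P + ent1 P + ent2 P) := by
  obtain ⟨h0, h1, h2, enc, dec1, dec2, hlim⟩ := h
  by_contra! hcon
  have hM := isPMF_markovized hP.1 hP.2
  obtain ⟨c, hc1, hc2⟩ := exists_between (show 3 - (R0 + R1 + R2) < ent0 P + ent1 P + ent2 P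
    by linarith)
  obtain ⟨d, hd1, hd2⟩ := exists_between hc2
  have hmgf := eventually_mgf_le hM.2 (fun z => Real.logb 2 (markovized P z)) (c := -d)
    (by rw [ent_sum_eq_entropy_markovized hP.1]; linarith)
  obtain ⟨s, hs, hs0⟩ := (hmgf.and self_mem_nhdsWithin).exists
  have hs0 : 0 < s := hs0
  have hbound : ∀ n : ℕ, 1 ≤ 2 * errProbNoFB (dueckW P) n R0 R1 R2 (enc n) (dec1 n) (dec2 n)
      + (2 : ℝ) ^ ((n : ℝ) * (s * (c - d)) + 0)
      + (2 : ℝ) ^ ((n : ℝ) * (3 - c - (R0 + R1 + R2)) + 3) := by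
    intro n
    have hA := one_sub_errProbNoFB_le (c := c) hM hs0 hs h0 h1 h2 (enc n) (dec1 n) (dec2 n)
    have hB := errProbNoFB_markovized_le hP n R0 R1 R2 (enc n) (dec1 n) (dec2 n)
    have hprod : (2 : ℝ) ^ ((n : ℝ) * (R0 + R1 + R2) - 3)
        ≤ (msgCard n R0 : ℝ) * (msgCard n R1 : ℝ) * (msgCard n R2 : ℝ) := by
      calc _ = (2 : ℝ) ^ ((n : ℝ) * R0 - 1) * (2 : ℝ) ^ ((n : ℝ) * R1 - 1)
            * (2 : ℝ) ^ ((n : ℝ) * R2 - 1) := by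
            rw [← Real.rpow_add (by norm_num), ← Real.rpow_add (by norm_num)]
            congr 1
            ring
        _ ≤ _ := by
            gcongr
            exacts [half_two_rpow_le_msgCard h0 n, half_two_rpow_le_msgCard h1 n,
              half_two_rpow_le_msgCard h2 n]
    have hC : 1 / ((msgCard n R0 : ℝ) * (msgCard n R1 : ℝ) * (msgCard n R2 : ℝ)) *
        ((2 : ℝ) ^ (-((n : ℝ) * c)) * 8 ^ n)
        ≤ (2 : ℝ) ^ ((n : ℝ) * (3 - c - (R0 + R1 + R2)) + 3) := by
      calc _ ≤ 1 / (2 : ℝ) ^ ((n : ℝ) * (R0 + R1 + R2) - 3)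
            * ((2 : ℝ) ^ (-((n : ℝ) * c)) * 8 ^ n) := by
            gcongr
        _ = 1 / (2 : ℝ) ^ ((n : ℝ) * (R0 + R1 + R2) - 3)
            * ((2 : ℝ) ^ (-((n : ℝ) * c)) * (2 : ℝ) ^ ((3 : ℝ) * n)) := by
            rw [Real.rpow_mul_natCast (by norm_num)]
            norm_num
        _ = _ := by
            rw [one_div, ← Real.rpow_neg (by norm_num), ← Real.rpow_add (by norm_num),
              ← Real.rpow_add (by norm_num)]
            congr 1
            ring
    rw [add_zero]
    linarith
  have hlim0 := ((hlim.const_mul 2).add (tendsto_two_rpow_linear (a := s * (c - d))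
    (by nlinarith) 0)).add (tendsto_two_rpow_linear (a := 3 - c - (R0 + R1 + R2)) (by linarith) 3)
  have := ge_of_tendsto' hlim0 hbound
  norm_num at this

theorem cNoFB_sumRate_le {P : Bool × Bool × Bool → ℝ} (hP : IsPMF P) {r : ℝ × ℝ × ℝ}
    (hr : r ∈ CNoFB (dueckW P)) : r.1 + r.2.1 + r.2.2 ≤ 3 - (ent0 P + ent1 P + ent2 P) :=
  closure_minimal (t := {r : ℝ × ℝ × ℝ | r.1 + r.2.1 + r.2.2 ≤ 3 - (ent0 P + ent1 P + ent2 P)})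
    (fun _ h => sumRate_le hP h)
    (isClosed_le (by fun_prop) continuous_const) hr

end SumRate

theorem bernCost_nonneg {η : ℝ} (h0 : 0 < η) (h1 : η < 1) : 0 ≤ bernCost η := by
  have hL1 : Real.logb 2 (1 - η) ≤ 0 := Real.logb_nonpos (by norm_num) (by linarith) (by linarith)
  have hL : Real.logb 2 η ≤ 0 := Real.logb_nonpos (by norm_num) h0.le h1.le
  unfold bernCost
  nlinarith

/-- The rates of the two-phase feedback scheme beat the sum rate bound. -/
theorem exists_phase_rates {G0 G1 G2 G12 τ : ℝ} (hG0 : 0 ≤ G0) (h1 : G0 + G1 ≤ 1) (h2 : G0 + G2 ≤ 1) (hG1 : 0 ≤ G1) (hG12 : 0 ≤ G12)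
    (hlt : G12 + 4 * τ < G1 + G2) (hτ0 : 0 ≤ τ) (hτ1 : τ < 1) :
    ∃ α R0 R1 R2 ε : ℝ, 0 ≤ α ∧ α ≤ 1 ∧ 0 ≤ R0 ∧ 0 ≤ R1 ∧ 0 ≤ R2 ∧ 0 < ε ∧
      R0 + (α * G0 + ε) < α ∧
      (α * (G12 + 2 * τ) + ε) + ((1 - α) * G0 + ε) < 1 - α ∧
      R1 + (α * τ + (1 - α) * G1 + ε) < 1 ∧ R2 + (α * τ + (1 - α) * G2 + ε) < 1 ∧
      3 - (G0 + G1 + G2) < R0 + R1 + R2 := by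
  have ha0 : 0 < 1 - G0 := by
    rcases hG1.eq_or_lt with h | h <;> linarith
  have hD2 : 0 < 1 - G0 + (G12 + 2 * τ) := by linarith
  have hD : 1 - G0 + (G12 + 2 * τ) < 1 - G0 + (G1 + G2 - 2 * τ) := by linarith
  obtain ⟨α, hl, hu⟩ := exists_between (div_lt_div_of_pos_left ha0 hD2 hD)
  have hα0 : 0 < α := (div_pos ha0 (hD2.trans hD)).trans hl
  rw [div_lt_iff₀ (hD2.trans hD)] at hl
  rw [lt_div_iff₀ hD2] at hu
  have hα1 : α ≤ 1 := by nlinarith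
  have hαa : 0 < α * (1 - G0) := mul_pos hα0 ha0
  have hατ : 0 < α * (1 - τ) := mul_pos hα0 (by linarith)
  obtain ⟨ε, hε0, hε⟩ := exists_between (show (0 : ℝ) < min
      (min ((α * (1 - G0 + (G1 + G2 - 2 * τ)) - (1 - G0)) / 6)
        ((1 - G0 - α * (1 - G0 + (G12 + 2 * τ))) / 2))
      (min (α * (1 - G0) / 2) (α * (1 - τ) / 2)) from
    lt_min (lt_min (by linarith) (by linarith)) (lt_min (by linarith) (by linarith)))
  simp only [lt_min_iff] at hε
  obtain ⟨⟨hε1, hε2⟩, hε3, hε4⟩ := hε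
  have hb1 : 0 ≤ (1 - α) * (1 - G1) := mul_nonneg (by linarith) (by linarith)
  have hb2 : 0 ≤ (1 - α) * (1 - G2) := mul_nonneg (by linarith) (by linarith)
  exact ⟨α, α * (1 - G0) - 2 * ε, 1 - α * τ - (1 - α) * G1 - 2 * ε,
    1 - α * τ - (1 - α) * G2 - 2 * ε, ε, hα0.le, hα1, by linarith, by linarith, by linarith, hε0,
    by linarith, by linarith, by linarith, by linarith, by linarith⟩

theorem exists_rates_gt {P : Bool × Bool × Bool → ℝ} (hP : IsPMF P)
    (h1 : entOf P (fun z => (z.1, z.2.1)) ≤ 1) (h2 : entOf P (fun z => (z.1, z.2.2)) ≤ 1)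
    (hnm : ¬ MarkovChain P (fun z => z.2.1) (fun z => z.1) (fun z => z.2.2)) :
    ∃ η : ℝ, 0 < η ∧ ∀ Q : Bool × Bool × Bool → ℝ, IsPMF Q →
      distOf Q (fun v => v.2.1) true ≤ η → distOf Q (fun v => v.2.2) true ≤ η →
      ∃ R0 R1 R2 : ℝ, AchievableFB (dueckNoisyW P Q) R0 R1 R2 ∧
        3 - (ent0 P + ent1 P + ent2 P) < R0 + R1 + R2 := by
  rw [← ent0_add_ent1 hP.1] at h1
  rw [← ent0_add_ent2 hP.1] at h2
  have hlt := ent12_lt hP.1 hP.2 hnm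
  have hG0 := ent0_nonneg hP.1 hP.2
  have hG1 := ent1_nonneg hP.1
  have hG2 := ent2_nonneg hP.1
  have hG12 := ent12_nonneg hP.1
  have hev := (tendsto_bernCost.eventually_lt_const
    (show (0 : ℝ) < min 1 ((ent1 P + ent2 P - ent12 P) / 4) by
      refine lt_min one_pos (by linarith))).and
    (Ioo_mem_nhdsGT (show (0 : ℝ) < 1 by norm_num))
  obtain ⟨η, hη, hη0, hη1⟩ := hev.exists
  have hτ0 := bernCost_nonneg hη0 hη1
  obtain ⟨hτ1, hτ2⟩ := lt_min_iff.1 hη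
  obtain ⟨α, R0, R1, R2, ε, hα0, hα1, hR0, hR1, hR2, hε, e0, eb, e1, e2, hsum⟩ :=
    exists_phase_rates hG0 h1 h2 hG1 hG12 (by linarith) hτ0 hτ1
  have hα1' : 0 ≤ 1 - α := by linarith
  refine ⟨η, hη0, fun Q hQ hq1 hq2 => ⟨R0, R1, R2, ?_, hsum⟩⟩
  exact achievableFB_of_phase hP hQ hη0 hη1 hq1 hq2 hα0 hα1 hR0 hR1 hR2
    (by positivity) (by positivity) (by positivity) (by positivity) (by positivity)
    (lt_add_of_pos_right _ hε) (lt_add_of_pos_right _ hε) (lt_add_of_pos_right _ hε)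
    (lt_add_of_pos_right _ hε) (lt_add_of_pos_right _ hε) e0 eb e1 e2

end BCFB

namespace BCFB

/-- **Corollary 3 (noisy feedback for Dueck).** If `Z₁ — Z₀ — Z₂` is not a Markov chain,
then for all sufficiently small feedback-noise marginals, noisy feedback strictly
enlarges the capacity region of the generalized Dueck DMBC. -/
theorem dueck_noisyFB_strict (PZ : Bool × Bool × Bool → ℝ) (hPZ : IsPMF PZ)
    (h1 : entOf PZ (fun z => (z.1, z.2.1)) ≤ 1)
    (h2 : entOf PZ (fun z => (z.1, z.2.2)) ≤ 1)
    (hnm : ¬ MarkovChain PZ (fun z => z.2.1) (fun z => z.1) (fun z => z.2.2)) :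
    ∃ qbar : ℝ, 0 < qbar ∧
      ∀ Q : Bool × Bool × Bool → ℝ, IsPMF Q →
        max (max (distOf Q (fun v => v.1) true) (distOf Q (fun v => v.2.1) true))
            (distOf Q (fun v => v.2.2) true) ≤ qbar →
        CNoFB (dueckW PZ) ⊂ CGenFB (dueckNoisyW PZ Q) := by
  obtain ⟨η, hη, hach⟩ := exists_rates_gt hPZ h1 h2 hnm
  refine ⟨η, hη, fun Q hQ hq => ?_⟩
  obtain ⟨R0, R1, R2, hA, hlt⟩ := hach Q hQ
    ((le_max_right _ _).trans ((le_max_left _ _).trans hq)) ((le_max_right _ _).trans hq)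
  refine Set.ssubset_iff_of_subset (cNoFB_subset hQ.2) |>.2 ⟨(R0, R1, R2), subset_closure hA, ?_⟩
  exact fun hmem => hlt.not_ge (cNoFB_sumRate_le hPZ hmem)

end BCFB
end
end

section
/- (Evaluation for the generalized Dueck channel) Let (Z₀,Z₁,Z₂) be binary random variables with an arbitrary joint law, and let (U₀,U₁,U₂) be i.i.d. uniform on {0,1}, independent of (Z₀,Z₁,Z₂). Define Y₁ = (U₁⊕Z₁, U₀⊕Z₀), Y₂ = (U₀⊕Z₀, U₂⊕Z₂), Ỹ = (Y₁,Y₂), V₁ = (U₀,U₁), and V₀ = (Z₀,Z₁). Then I(U₀,U₁;Y₁,V₁) − I(U₀,U₁,U₂,Ỹ;V₀,V₁|Y₁) = 2 − H(Z₀,Z₁). -/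
open scoped BigOperators Classical

noncomputable section

namespace BCFB

/-- The entropy as an expectation over the sample space. -/
lemma entOf_eq_sum {Ω A : Type*} [Fintype Ω] [Fintype A] (w : Ω → ℝ) (X : Ω → A) :
    entOf w X = -∑ ω, w ω * Real.logb 2 (distOf w X (X ω)) := by
  unfold entOf
  congr 1
  have h (a : A) : distOf w X a * Real.logb 2 (distOf w X a) =
      ∑ ω, if X ω = a then w ω * Real.logb 2 (distOf w X (X ω)) else 0 := by
    nth_rewrite 1 [distOf]
    rw [prOf, Finset.sum_mul]
    refine Finset.sum_congr rfl fun ω _ => ?_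
    split_ifs with hX
    · rw [hX]
    · simp
  simp_rw [h]
  rw [Finset.sum_comm]
  simp

/-- Random variables that determine each other have the same entropy. -/
lemma entOf_congr {Ω A B : Type*} [Fintype Ω] [Fintype A] [Fintype B] (w : Ω → ℝ)
    (X : Ω → A) (Y : Ω → B) (h : ∀ ω ω', X ω = X ω' ↔ Y ω = Y ω') :
    entOf w X = entOf w Y := by
  simp only [entOf_eq_sum, distOf, h]

/-- The entropy of a random variable with constant distribution. -/
lemma entOf_eq_of_distOf_const {Ω A : Type*} [Fintype Ω] [Fintype A] {w : Ω → ℝ}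
    (hw : ∑ ω, w ω = 1) {X : Ω → A} {c : ℝ} (h : ∀ a, distOf w X a = c) :
    entOf w X = -Real.logb 2 c := by
  simp only [entOf_eq_sum, h, ← Finset.sum_mul, hw, one_mul]

lemma le_distOf_apply {Ω A : Type*} [Fintype Ω] {w : Ω → ℝ} (hw : ∀ ω, 0 ≤ w ω)
    (X : Ω → A) (ω : Ω) : w ω ≤ distOf w X (X ω) := by
  unfold distOf prOf
  have h := Finset.single_le_sum (s := Finset.univ)
    (f := fun ω' => if X ω' = X ω then w ω' else 0)
    (fun ω' _ => by split_ifs <;> simp [hw]) (Finset.mem_univ ω)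
  simpa using h

lemma logb_two_one_fourth : Real.logb 2 (1 / 4 : ℝ) = -2 := by
  rw [show (1 / 4 : ℝ) = 2 ^ (-2 : ℝ) by norm_num [Real.rpow_neg],
    Real.logb_rpow (by norm_num) (by norm_num)]

/-- The entropy of a pair whose law is that of the first component times `1 / 4`. -/
lemma entOf_eq_add_two {Ω Ω' A B : Type*} [Fintype Ω] [Fintype Ω'] [Fintype A] [Fintype B]
    {p : Ω → ℝ} (hp : IsPMF p) {q : Ω' → ℝ} (hq : ∑ u, q u = 1) {X : Ω → A} {Y : Ω' → B}
    (h : ∀ a b, distOf (fun ω : Ω × Ω' => p ω.1 * q ω.2) (fun ω => (X ω.1, Y ω.2)) (a, b) =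
      distOf p X a * (1 / 4)) :
    entOf (fun ω : Ω × Ω' => p ω.1 * q ω.2) (fun ω => (X ω.1, Y ω.2)) = entOf p X + 2 := by
  have key (ω : Ω × Ω') : p ω.1 * q ω.2 * Real.logb 2 (distOf p X (X ω.1) * (1 / 4)) =
      (p ω.1 * Real.logb 2 (distOf p X (X ω.1)) - 2 * p ω.1) * q ω.2 := by
    rcases eq_or_lt_of_le (hp.1 ω.1) with h0 | h0
    · simp [← h0]
    · rw [Real.logb_mul (h0.trans_le (le_distOf_apply hp.1 X ω.1)).ne' (by norm_num),
        logb_two_one_fourth]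
      ring
  simp only [entOf_eq_sum, h, key]
  rw [Fintype.sum_prod_type]
  simp only [← Finset.mul_sum, hq, mul_one, Finset.sum_sub_distrib, hp.2]
  ring

/-- **Evaluation for the generalized Dueck channel.** With `(U₀,U₁,U₂)` i.i.d. uniform
independent of `(Z₀,Z₁,Z₂) ~ PZ`, `Y₁ = (U₁⊕Z₁, U₀⊕Z₀)`, `Y₂ = (U₀⊕Z₀, U₂⊕Z₂)`,
`Ỹ = (Y₁,Y₂)`, `V₁ = (U₀,U₁)`, `V₀ = (Z₀,Z₁)`:
`I(U₀,U₁;Y₁,V₁) − I(U₀,U₁,U₂,Ỹ;V₀,V₁|Y₁) = 2 − H(Z₀,Z₁)`. -/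
theorem dueck_evaluation (PZ : Bool × Bool × Bool → ℝ) (hPZ : IsPMF PZ) :
    (let w : (Bool × Bool × Bool) × Bool × Bool × Bool → ℝ := fun ω => PZ ω.1 * (1 / 8)
     let Yr1 := fun ω : (Bool × Bool × Bool) × Bool × Bool × Bool =>
       (Bool.xor ω.2.2.1 ω.1.2.1, Bool.xor ω.2.1 ω.1.1)
     let Yr2 := fun ω : (Bool × Bool × Bool) × Bool × Bool × Bool =>
       (Bool.xor ω.2.1 ω.1.1, Bool.xor ω.2.2.2 ω.1.2.2)
     miOf w (fun ω => (ω.2.1, ω.2.2.1)) (fun ω => (Yr1 ω, (ω.2.1, ω.2.2.1)))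
       - cmiOf w (fun ω => (ω.2.1, ω.2.2.1, ω.2.2.2, (Yr1 ω, Yr2 ω)))
           (fun ω => ((ω.1.1, ω.1.2.1), (ω.2.1, ω.2.2.1))) Yr1)
      = 2 - entOf PZ (fun z => (z.1, z.2.1)) := by
  extract_lets w Yr1 Yr2
  have hsum := hPZ.2
  simp only [Fintype.sum_prod_type, Fintype.sum_bool] at hsum
  have hw : ∑ ω, w ω = 1 := by
    simp only [w, Fintype.sum_prod_type, Fintype.sum_bool]
    linarith
  have hU : entOf w (fun ω => (ω.2.1, ω.2.2.1)) = 2 := by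
    rw [entOf_eq_of_distOf_const hw (c := 1 / 4), logb_two_one_fourth, neg_neg]
    rintro ⟨_ | _, _ | _⟩ <;>
    · simp [distOf, prOf, w, Fintype.sum_prod_type]
      linarith
  have hY : entOf w Yr1 = 2 := by
    rw [entOf_eq_of_distOf_const hw (c := 1 / 4), logb_two_one_fourth, neg_neg]
    rintro ⟨_ | _, _ | _⟩ <;>
    · simp [distOf, prOf, w, Yr1, Fintype.sum_prod_type]
      linarith
  have hZU : entOf w (fun ω => ((ω.1.1, ω.1.2.1), (ω.2.1, ω.2.2.1))) =
      entOf PZ (fun z => (z.1, z.2.1)) + 2 := by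
    refine entOf_eq_add_two (q := fun _ : Bool × Bool × Bool => 1 / 8)
      (X := fun z => (z.1, z.2.1)) (Y := fun u => (u.1, u.2.1)) hPZ (by norm_num) ?_
    rintro ⟨_ | _, _ | _⟩ ⟨_ | _, _ | _⟩ <;>
    · simp [distOf, prOf, Fintype.sum_prod_type]
      ring
  have hYU : entOf w (fun ω => (Yr1 ω, (ω.2.1, ω.2.2.1))) =
      entOf w (fun ω => ((ω.2.1, ω.2.2.1), (Yr1 ω, (ω.2.1, ω.2.2.1)))) :=
    entOf_congr _ _ _ fun ω ω' => by simp only [Prod.mk.injEq]; tauto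
  have hZUY : entOf w (fun ω => (((ω.1.1, ω.1.2.1), (ω.2.1, ω.2.2.1)), Yr1 ω)) =
      entOf w (fun ω => ((ω.1.1, ω.1.2.1), (ω.2.1, ω.2.2.1))) :=
    entOf_congr _ _ _ fun ω ω' => by
      simp only [Yr1, Prod.mk.injEq]
      constructor <;> simp +contextual
  have hall : entOf w (fun ω => ((ω.2.1, ω.2.2.1, ω.2.2.2, (Yr1 ω, Yr2 ω)), Yr1 ω)) =
      entOf w (fun ω => ((ω.2.1, ω.2.2.1, ω.2.2.2, (Yr1 ω, Yr2 ω)),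
        ((ω.1.1, ω.1.2.1), (ω.2.1, ω.2.2.1)), Yr1 ω)) :=
    entOf_congr _ _ _ fun ω ω' => by
      simp only [Yr1, Yr2, Prod.mk.injEq]
      constructor <;> simp +contextual
  unfold miOf cmiOf
  linarith

end BCFB
end
end

section
/- (Evaluation for the noisy Blackwell channel) Let p ∈ (0,1/2) and let α, β ≥ 0 with α+β ≤ 1. Let U₀ be uniform on {0,1}, and let (U₁,U₂) ∈ {0,1}² have conditional law given U₀ = 0 assigning probabilities α, 1−α−β, 0, β to (0,0), (0,1), (1,0), (1,1) respectively, and given U₀ = 1 assigning probabilities β, 1−α−β, 0, α to (0,0), (0,1), (1,0), (1,1) respectively. Let Z ~ Bern(p) be independent of (U₀,U₁,U₂). Define X = U₁+U₂ ∈ {0,1,2}, V₁ = 1{X ≥ 1}, V₂ = 1{X = 2}, Y₁ = V₁⊕Z, Y₂ = V₂⊕Z, V₀ = Z, and Ỹ = (Y₁,Y₂). Then I(U₀;Y₁,V₁) − I(V₀;X,Ỹ|Y₁) = h_b(((α+β)/2) ⋆ p) − (1/2)(h_b(α)+h_b(β)) − h_b(p), where a ⋆ p := a(1−p) + (1−a)p.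 -/
open scoped BigOperators Classical

noncomputable section

namespace BCFB

section Entropy

variable {Ω A B : Type*} [Fintype Ω] [Fintype A] [Fintype B]

theorem sum_distOf (w : Ω → ℝ) (X : Ω → A) : ∑ a, distOf w X a = ∑ ω, w ω := by
  simp only [distOf, prOf]
  rw [Finset.sum_comm]
  simp

/-- Random variables that determine one another have the same entropy. -/
theorem entOf_eq_of_comp (w : Ω → ℝ) {X : Ω → A} {Y : Ω → B} (f : A → B) (g : B → A)
    (hf : ∀ ω, f (X ω) = Y ω) (hg : ∀ ω, g (Y ω) = X ω) : entOf w X = entOf w Y := by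
  have hX : ∀ a, distOf w X a ≠ 0 → ∃ ω, X ω = a := by
    intro a ha
    by_contra! h
    exact ha (by simp [distOf, prOf, h])
  have hY : ∀ b, distOf w Y b ≠ 0 → ∃ ω, Y ω = b := by
    intro b hb
    by_contra! h
    exact hb (by simp [distOf, prOf, h])
  have key : ∀ ω, distOf w Y (Y ω) = distOf w X (X ω) := by
    intro ω
    have h : ∀ ω', Y ω' = Y ω ↔ X ω' = X ω := fun ω' =>
      ⟨fun h => by rw [← hg, h, hg], fun h => by rw [← hf, h, hf]⟩
    simp only [distOf, h]
  unfold entOf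
  congr 1
  refine Finset.sum_bij_ne_zero (fun a _ _ => f a) (by simp) ?_ ?_ ?_
  · intro a _ ha a' _ ha' h
    obtain ⟨ω, rfl⟩ := hX a (left_ne_zero_of_mul ha)
    obtain ⟨ω', rfl⟩ := hX a' (left_ne_zero_of_mul ha')
    rw [← hg, ← hg ω', ← hf, h, hf]
  · intro b _ hb
    obtain ⟨ω, rfl⟩ := hY b (left_ne_zero_of_mul hb)
    rw [key] at hb
    exact ⟨X ω, Finset.mem_univ _, hb, hf ω⟩
  · intro a _ ha
    obtain ⟨ω, rfl⟩ := hX a (left_ne_zero_of_mul ha)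
    rw [hf, key]

theorem mul_mul_logb_mul (b x y : ℝ) :
    x * y * Real.logb b (x * y) = y * (x * Real.logb b x) + x * (y * Real.logb b y) := by
  rcases eq_or_ne x 0 with rfl | hx
  · simp
  rcases eq_or_ne y 0 with rfl | hy
  · simp
  rw [Real.logb_mul hx hy]
  ring

/-- Entropy is additive over independent random variables. -/
theorem entOf_prod_of_indepRV {w : Ω → ℝ} (hw : ∑ ω, w ω = 1) {X : Ω → A} {Y : Ω → B}
    (h : IndepRV w X Y) : entOf w (fun ω => (X ω, Y ω)) = entOf w X + entOf w Y := by
  unfold entOf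
  simp only [Fintype.sum_prod_type, h _ _, mul_mul_logb_mul, Finset.sum_add_distrib,
    ← Finset.mul_sum, ← Finset.sum_mul, sum_distOf, hw]
  ring

theorem entOf_bool {w : Ω → ℝ} (hw : ∑ ω, w ω = 1) (X : Ω → Bool) :
    entOf w X = hb (distOf w X true) := by
  have h := sum_distOf w X
  rw [hw, Fintype.sum_bool] at h
  rw [entOf, Fintype.sum_bool, hb, ← h, add_sub_cancel_left]
  ring

theorem hb_one_sub (u : ℝ) : hb (1 - u) = hb u := by
  simp only [hb, sub_sub_cancel]
  ring

/-- The chain rule for a fair bit followed by a bit of conditional bias `a` or `b`. -/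
theorem entOf_bool_prod_of_uniform {w : Ω → ℝ} {X Y : Ω → Bool} {a b : ℝ}
    (h₁ : distOf w (fun ω => (X ω, Y ω)) (false, false) = 1 / 2 * a)
    (h₂ : distOf w (fun ω => (X ω, Y ω)) (false, true) = 1 / 2 * (1 - a))
    (h₃ : distOf w (fun ω => (X ω, Y ω)) (true, false) = 1 / 2 * b)
    (h₄ : distOf w (fun ω => (X ω, Y ω)) (true, true) = 1 / 2 * (1 - b)) :
    entOf w (fun ω => (X ω, Y ω)) = 1 + 1 / 2 * (hb a + hb b) := by
  have hlog : Real.logb 2 (1 / 2) = -1 := by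
    rw [one_div, Real.logb_inv, Real.logb_self_eq_one one_lt_two]
  simp only [entOf, Fintype.sum_prod_type, Fintype.sum_bool, h₁, h₂, h₃, h₄, mul_mul_logb_mul,
    hlog, hb]
  ring

end Entropy

/-- **Evaluation for the noisy Blackwell channel.** -/
theorem blackwell_evaluation (p α β : ℝ) (hp0 : 0 < p) (hp : p < 1 / 2)
    (hα : 0 ≤ α) (hβ : 0 ≤ β) (hαβ : α + β ≤ 1) :
    (let pU : Bool → Bool × Bool → ℝ := fun u0 u =>
       if u = (false, false) then (if u0 then β else α)
       else if u = (false, true) then 1 - α - β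
       else if u = (true, false) then 0
       else (if u0 then α else β)
     let w : (Bool × Bool × Bool) × Bool → ℝ :=
       fun ω => (1 / 2) * pU ω.1.1 ω.1.2 * (if ω.2 then p else 1 - p)
     let Xr : (Bool × Bool × Bool) × Bool → Fin 3 :=
       fun ω => (if ω.1.2.1 then 1 else 0) + (if ω.1.2.2 then 1 else 0)
     let V1 := fun ω : (Bool × Bool × Bool) × Bool => decide (1 ≤ (Xr ω : ℕ))
     let V2 := fun ω : (Bool × Bool × Bool) × Bool => decide ((Xr ω : ℕ) = 2)
     let Yr1 := fun ω : (Bool × Bool × Bool) × Bool => Bool.xor (V1 ω) ω.2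
     let Yr2 := fun ω : (Bool × Bool × Bool) × Bool => Bool.xor (V2 ω) ω.2
     miOf w (fun ω => ω.1.1) (fun ω => (Yr1 ω, V1 ω))
       - cmiOf w (fun ω => ω.2) (fun ω => (Xr ω, (Yr1 ω, Yr2 ω))) Yr1)
      = hb (((α + β) / 2) * (1 - p) + (1 - (α + β) / 2) * p)
        - (1 / 2) * (hb α + hb β) - hb p := by
  extract_lets pU w Xr V1 V2 Yr1 Yr2
  have hV1 : ∀ ω, V1 ω = (ω.1.2.1 || ω.1.2.2) := by
    rintro ⟨⟨u₀, u₁, u₂⟩, z⟩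
    cases u₁ <;> cases u₂ <;> rfl
  have hY1 : ∀ ω, Yr1 ω = Bool.xor (ω.1.2.1 || ω.1.2.2) ω.2 := fun ω => by rw [← hV1]
  have hw : ∑ ω, w ω = 1 := by
    simp [w, pU, Fintype.sum_prod_type]
    ring
  have hU : entOf w (fun ω => ω.1.1) = 1 := by
    have hd : distOf w (fun ω => ω.1.1) true = 2⁻¹ := by
      simp [distOf, prOf, w, pU, Fintype.sum_prod_type]
      ring
    rw [entOf_bool hw, hd, hb, Real.logb_inv, show (1 : ℝ) - 2⁻¹ = 2⁻¹ by norm_num,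
      Real.logb_inv, Real.logb_self_eq_one one_lt_two]
    norm_num
  have hZ : entOf w (fun ω => ω.2) = hb p := by
    rw [entOf_bool hw]
    congr 1
    simp [distOf, prOf, w, pU, Fintype.sum_prod_type]
    ring
  have hY : entOf w Yr1 = hb (((α + β) / 2) * (1 - p) + (1 - (α + β) / 2) * p) := by
    rw [entOf_bool hw, ← hb_one_sub]
    congr 1
    simp [distOf, prOf, hY1, w, pU, Fintype.sum_prod_type]
    ring
  have hUV : entOf w (fun ω => (ω.1.1, V1 ω)) = 1 + 1 / 2 * (hb α + hb β) := by
    apply entOf_bool_prod_of_uniform <;>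
    · simp [distOf, prOf, hV1, w, pU, Fintype.sum_prod_type]
      ring
  have hind : IndepRV w (fun ω => (ω.1.1, V1 ω)) (fun ω => ω.2) := by
    rintro ⟨u, v⟩ z
    cases u <;> cases v <;> cases z <;>
    · simp [distOf, prOf, hV1, w, pU, Fintype.sum_prod_type]
      ring
  have hUYV : entOf w (fun ω => (ω.1.1, (Yr1 ω, V1 ω)))
      = entOf w (fun ω => ((ω.1.1, V1 ω), ω.2)) :=
    entOf_eq_of_comp w (fun a => ((a.1, a.2.2), Bool.xor a.2.2 a.2.1))
      (fun b => (b.1.1, (Bool.xor b.1.2 b.2, b.1.2)))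
      (fun ω => by simp [Yr1]) (fun ω => by simp [Yr1])
  have hYV : entOf w (fun ω => (Yr1 ω, V1 ω)) = entOf w (fun ω => (ω.2, Yr1 ω)) :=
    entOf_eq_of_comp w (fun a => (Bool.xor a.2 a.1, a.1)) (fun b => (b.2, Bool.xor b.2 b.1))
      (fun ω => by simp [Yr1]) (fun ω => by simp [Yr1])
  have hXY : entOf w (fun ω => ((Xr ω, (Yr1 ω, Yr2 ω)), Yr1 ω))
      = entOf w (fun ω => (ω.2, (Xr ω, (Yr1 ω, Yr2 ω)), Yr1 ω)) :=
    entOf_eq_of_comp w (fun a => (Bool.xor (decide (1 ≤ (a.1.1 : ℕ))) a.2, a)) Prod.snd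
      (fun ω => by simp [Yr1, V1]) (fun ω => rfl)
  rw [miOf, cmiOf, hUYV, hYV, hXY, entOf_prod_of_indepRV hw hind, hU, hZ, hUV, hY]
  ring

end BCFB
end
end
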